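/- arXiv:1911.12940 — 4 statements merged into one kernel-verified Lean document; each statement's English description precedes it below -/
import Mathlib

section
/- For a regular T2 space X the following are equivalent: (1) X has a point-countable base; (2) ℱ₂(X) is a Fréchet–Urysohn space with a point-countable k-network; (3) 𝒦(X) is a Fréchet–Urysohn space with a point-countable k-network; (4) 𝒦(X) has a point-countable weak base; (5) 𝒦(X) has a compact-countable weak base; (6) 𝒦(X) has a point-countable base. -/
open TopologicalSpace Set

/-- The hyperspace `𝒦(X)` of nonempty compact subsets of `X`. -/
structure VHyper (X : Type*) [TopologicalSpace X] where
  carrier : Set X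
  isCompact' : IsCompact carrier
  nonempty' : carrier.Nonempty

namespace VHyper

variable {X : Type*} [TopologicalSpace X]

/-- The basic Vietoris set `⟨P₁, …, P_r⟩` determined by a finite family of subsets of `X`:
all nonempty compact sets contained in the union and meeting every member. -/
def vbox (Ps : Finset (Set X)) : Set (VHyper X) :=
  {A : VHyper X | A.carrier ⊆ ⋃₀ (Ps : Set (Set X)) ∧ ∀ P ∈ Ps, (A.carrier ∩ P).Nonempty}

/-- The Vietoris topology on `𝒦(X)`, generated by the sets `⟨U₁, …, U_k⟩`
with all `U_i` open. -/
instance : TopologicalSpace (VHyper X) :=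
  TopologicalSpace.generateFrom
    {S : Set (VHyper X) | ∃ Ps : Finset (Set X), (∀ U ∈ Ps, IsOpen U) ∧ S = vbox Ps}

end VHyper

/-- `ℱ(X)`: the subspace of `𝒦(X)` consisting of the nonempty finite subsets of `X`. -/
def VFin (X : Type*) [TopologicalSpace X] := {A : VHyper X // A.carrier.Finite}

instance (X : Type*) [TopologicalSpace X] : TopologicalSpace (VFin X) :=
  inferInstanceAs (TopologicalSpace {A : VHyper X // A.carrier.Finite})

/-- `ℱ₂(X)`: the subspace of `𝒦(X)` consisting of the nonempty subsets of `X` of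
cardinality at most 2. -/
def VFin2 (X : Type*) [TopologicalSpace X] := {A : VHyper X // A.carrier.encard ≤ 2}

instance (X : Type*) [TopologicalSpace X] : TopologicalSpace (VFin2 X) :=
  inferInstanceAs (TopologicalSpace {A : VHyper X // A.carrier.encard ≤ 2})

/-- The family `ℬ = {⟨P₁,…,P_r⟩ : P₁,…,P_r ∈ Pfam, r ∈ ℕ}` of basic Vietoris sets built from
members of `Pfam`. -/
def boxFamily {X : Type*} [TopologicalSpace X] (Pfam : Set (Set X)) : Set (Set (VHyper X)) :=
  {B | ∃ Ps : Finset (Set X), Ps.Nonempty ∧ ↑Ps ⊆ Pfam ∧ B = VHyper.vbox Ps}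

section Defs

variable {Y : Type*} [TopologicalSpace Y]

/-- `Pfam` is a k-network: for every compact `C` and open `U ⊇ C` there is a finite
subfamily `Qfam ⊆ Pfam` with `C ⊆ ⋃Qfam ⊆ U`. -/
def IsKNetwork (Pfam : Set (Set Y)) : Prop :=
  ∀ C : Set Y, IsCompact C → ∀ U : Set Y, IsOpen U → C ⊆ U →
    ∃ Qfam : Set (Set Y), Qfam ⊆ Pfam ∧ Qfam.Finite ∧ C ⊆ ⋃₀ Qfam ∧ ⋃₀ Qfam ⊆ U

/-- Every point lies in at most countably many members of `Pfam`. -/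
def PointCountableFam (Pfam : Set (Set Y)) : Prop :=
  ∀ y : Y, {P ∈ Pfam | y ∈ P}.Countable

/-- Every compact set meets at most countably many members of `Pfam`. -/
def CompactCountableFam (Pfam : Set (Set Y)) : Prop :=
  ∀ C : Set Y, IsCompact C → {P ∈ Pfam | (C ∩ P).Nonempty}.Countable

/-- Every point has a neighborhood meeting at most countably many members of `Pfam`. -/
def LocallyCountableFam (Pfam : Set (Set Y)) : Prop :=
  ∀ y : Y, ∃ O ∈ nhds y, {P ∈ Pfam | (O ∩ P).Nonempty}.Countable

/-- Every point has a neighborhood meeting only finitely many members of `Pfam`. -/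
def LocallyFiniteFam (Pfam : Set (Set Y)) : Prop :=
  ∀ y : Y, ∃ O ∈ nhds y, {P ∈ Pfam | (O ∩ P).Nonempty}.Finite

/-- Every compact set meets only finitely many members of `Pfam`. -/
def CompactFiniteFam (Pfam : Set (Set Y)) : Prop :=
  ∀ C : Set Y, IsCompact C → {P ∈ Pfam | (C ∩ P).Nonempty}.Finite

/-- `Pfam` is a base for the topology: all members are open, and every open set is a union of
members around each of its points. -/
def IsBaseFam (Pfam : Set (Set Y)) : Prop :=
  (∀ P ∈ Pfam, IsOpen P) ∧ ∀ U : Set Y, IsOpen U → ∀ y ∈ U, ∃ P ∈ Pfam, y ∈ P ∧ P ⊆ U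

/-- `Pfam` is hereditarily closure-preserving: whenever `S P ⊆ P` is chosen for each `P ∈ Pfam`,
the resulting family is closure-preserving. -/
def IsHCP (Pfam : Set (Set Y)) : Prop :=
  ∀ S : Set Y → Set Y, (∀ P ∈ Pfam, S P ⊆ P) →
    ∀ Qfam ⊆ Pfam, closure (⋃ P ∈ Qfam, S P) = ⋃ P ∈ Qfam, closure (S P)

/-- `Pfam = ⋃_{y} Pfam y` is a weak base: each `Pfam y` consists of sets containing `y`, is directed
downward, every open neighborhood of `y` contains a member of `Pfam y`, and a set `G` is open
whenever each of its points has a member of its family inside `G`. -/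
def IsWeakBase (Pfam : Y → Set (Set Y)) : Prop :=
  (∀ y, ∀ P ∈ Pfam y, y ∈ P) ∧
  (∀ y, ∀ U ∈ Pfam y, ∀ V ∈ Pfam y, ∃ W ∈ Pfam y, W ⊆ U ∩ V) ∧
  (∀ y, ∀ U : Set Y, IsOpen U → y ∈ U → ∃ P ∈ Pfam y, P ⊆ U) ∧
  (∀ G : Set Y, (∀ y ∈ G, ∃ P ∈ Pfam y, P ⊆ G) → IsOpen G)

end Defs

/-- An ℵ-space: a space with a σ-locally finite k-network. -/
def IsAlephSpace (Y : Type*) [TopologicalSpace Y] : Prop :=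
  ∃ Pfam : ℕ → Set (Set Y), (∀ n, LocallyFiniteFam (Pfam n)) ∧ IsKNetwork (⋃ n, Pfam n)

/-- A space with a σ-hereditarily closure-preserving k-network. -/
def HasSigmaHCPKNetwork (Y : Type*) [TopologicalSpace Y] : Prop :=
  ∃ Pfam : ℕ → Set (Set Y), (∀ n, IsHCP (Pfam n)) ∧ IsKNetwork (⋃ n, Pfam n)

/-- k*-metrizable: a space with a σ-compact-finite k-network. -/
def KStarMetrizable (Y : Type*) [TopologicalSpace Y] : Prop :=
  ∃ Pfam : ℕ → Set (Set Y), (∀ n, CompactFiniteFam (Pfam n)) ∧ IsKNetwork (⋃ n, Pfam n)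

section Helpers

open Filter Topology

set_option linter.unusedSectionVars false

universe u
variable {Y : Type u} [TopologicalSpace Y]

theorem countable_meet {N : Set (Set Y)} (hN : PointCountableFam N) {D : Set Y}
    (hD : D.Countable) : {P ∈ N | (D ∩ P).Nonempty}.Countable := by
  refine (hD.biUnion (fun d _ => hN d)).mono ?_
  rintro P ⟨hP, d, hd, hdP⟩
  exact mem_biUnion hd ⟨hP, hdP⟩

theorem closing {N : Set (Set Y)} (hN : PointCountableFam N) (g : Set (Set Y) → Set Y)
    (hg : ∀ F, (g F).Countable) :
    ∃ D : Set Y, D.Countable ∧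
      ∀ F ⊆ {P ∈ N | (D ∩ P).Nonempty}, F.Finite → g F ⊆ D := by
  let step : Set Y → Set Y := fun D =>
    D ∪ ⋃ F ∈ {F : Set (Set Y) | F.Finite ∧ F ⊆ {P ∈ N | (D ∩ P).Nonempty}}, g F
  let E : ℕ → Set Y := fun n => step^[n] ∅
  have hE : ∀ n, E (n + 1) = step (E n) := fun n => Function.iterate_succ_apply' step n ∅
  have hc : ∀ n, (E n).Countable := by
    intro n
    induction n with
    | zero => exact countable_empty
    | succ n ih =>
      rw [hE]
      exact ih.union ((countable_ofPred_finite_subset (countable_meet hN ih)).biUnion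
        (fun F _ => hg F))
  have hmono : Monotone E := monotone_nat_of_le_succ (fun n => by
    rw [hE]; exact subset_union_left)
  refine ⟨⋃ n, E n, countable_iUnion hc, ?_⟩
  intro F hF hfin
  have : ∃ n, F ⊆ {P ∈ N | (E n ∩ P).Nonempty} := by
    induction F, hfin using Set.Finite.induction_on with
    | empty => exact ⟨0, empty_subset _⟩
    | @insert P F hPF hf ih =>
      obtain ⟨n, hn⟩ := ih (fun Q hQ => hF (mem_insert_of_mem _ hQ))
      obtain ⟨hP, d, hd, hdP⟩ := hF (mem_insert _ _)
      obtain ⟨m, hm⟩ := mem_iUnion.1 hd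
      refine ⟨max n m, insert_subset ⟨hP, d, hmono (le_max_right _ _) hm, hdP⟩ ?_⟩
      intro Q hQ
      obtain ⟨h1, e, he, heQ⟩ := hn hQ
      exact ⟨h1, e, hmono (le_max_left _ _) he, heQ⟩
  obtain ⟨n, hn⟩ := this
  refine subset_trans ?_ (subset_iUnion E (n + 1))
  rw [hE]
  intro y hy
  exact Or.inr (mem_iUnion₂.2 ⟨F, ⟨hfin, hn⟩, hy⟩)

theorem compactCountable_of_base [T1Space Y] {B : Set (Set Y)} (hB : IsBaseFam B)
    (hN : PointCountableFam B) : CompactCountableFam B := by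
  classical
  intro K hK
  obtain ⟨D, hD, hcl⟩ := closing hN
    (fun F => if h : (K \ ⋃₀ F).Nonempty then {h.some} else ∅)
    (fun F => by split_ifs <;> simp)
  have hdense : K ⊆ closure (D ∩ K) := by
    intro x hx
    by_contra hxc
    have hC : IsCompact (K ∩ closure (D ∩ K)) := hK.inter_right isClosed_closure
    have h1 : ∀ y ∈ K ∩ closure (D ∩ K), ∃ P ∈ B, y ∈ P ∧ x ∉ P := by
      intro y hy
      have hne : y ≠ x := by rintro rfl; exact hxc hy.2
      obtain ⟨P, hP, hyP, hPs⟩ := hB.2 {x}ᶜ isOpen_compl_singleton y hne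
      exact ⟨P, hP, hyP, fun h => hPs h rfl⟩
    choose! p hp1 hp2 hp3 using h1
    obtain ⟨t, ht, hcov⟩ := hC.elim_nhds_subcover p
      (fun y hy => (hB.1 _ (hp1 y hy)).mem_nhds (hp2 y hy))
    have hg := hcl (p '' (t : Set Y)) (by
      rintro _ ⟨y, hy, rfl⟩
      refine ⟨hp1 y (ht y hy), ?_⟩
      obtain ⟨d, hd1, hd2⟩ := mem_closure_iff.1 (ht y hy).2 _ (hB.1 _ (hp1 y (ht y hy)))
        (hp2 y (ht y hy))
      exact ⟨d, hd2.1, hd1⟩) (t.finite_toSet.image _)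
    have hne : (K \ ⋃₀ (p '' (t : Set Y))).Nonempty := by
      refine ⟨x, hx, ?_⟩
      rintro ⟨_, ⟨y, hy, rfl⟩, hxy⟩
      exact hp3 y (ht y hy) hxy
    rw [dif_pos hne, singleton_subset_iff] at hg
    have h2 := hne.some_mem
    have h3 := hcov ⟨h2.1, subset_closure ⟨hg, h2.1⟩⟩
    rw [mem_iUnion₂] at h3
    obtain ⟨y, hy, h4⟩ := h3
    exact h2.2 ⟨_, ⟨y, hy, rfl⟩, h4⟩
  refine (countable_meet hN hD).mono ?_
  rintro P ⟨hP, x, hx, hxP⟩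
  obtain ⟨d, hd1, hd2⟩ := mem_closure_iff.1 (hdense hx) P (hB.1 P hP) hxP
  exact ⟨hP, d, hd2.1, hd1⟩

theorem countable_minimal [FrechetUrysohnSpace Y] {N : Set (Set Y)} (hN : PointCountableFam N)
    (E : Set Y) : {F : Set (Set Y) | F ⊆ N ∧ F.Finite ∧ E ⊆ interior (⋃₀ F) ∧
      ∀ R ⊆ F, E ⊆ interior (⋃₀ R) → R = F}.Countable := by
  classical
  have key : ∀ R : Set (Set Y), ∃ C : Set Y, C.Countable ∧ (¬ E ⊆ interior (⋃₀ R) →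
      ∃ e ∈ E, C ⊆ (⋃₀ R)ᶜ ∧ e ∈ closure C) := by
    intro R
    by_cases h : E ⊆ interior (⋃₀ R)
    · exact ⟨∅, countable_empty, fun h' => absurd h h'⟩
    · obtain ⟨e, he, hei⟩ := not_subset.1 h
      have : e ∈ closure (⋃₀ R)ᶜ := by rw [closure_compl]; exact hei
      obtain ⟨s, hs, hlim⟩ := mem_closure_iff_seq_limit.1 this
      exact ⟨range s, countable_range s, fun _ => ⟨e, he, range_subset_iff.2 hs,
        mem_closure_of_tendsto hlim (Eventually.of_forall mem_range_self)⟩⟩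
  choose g hg hg2 using key
  obtain ⟨D, hD, hcl⟩ := closing hN g hg
  refine (countable_ofPred_finite_subset (countable_meet hN hD)).mono ?_
  rintro F ⟨hFN, hfin, hEF, hmin⟩
  refine ⟨hfin, ?_⟩
  let R := F ∩ {P ∈ N | (D ∩ P).Nonempty}
  have hRD : g R ⊆ D := hcl R inter_subset_right (hfin.subset inter_subset_left)
  by_cases h : E ⊆ interior (⋃₀ R)
  · rw [← hmin R inter_subset_left h]; exact inter_subset_right
  · exfalso
    obtain ⟨e, he, hC, hcl⟩ := hg2 R h
    obtain ⟨c, hc1, hc2⟩ := mem_closure_iff.1 hcl _ isOpen_interior (hEF he)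
    obtain ⟨P, hP, hcP⟩ := interior_subset hc1
    exact hC hc2 ⟨P, ⟨hP, hFN hP, c, hRD hc2, hcP⟩, hcP⟩

/-- Burke–Michael type theorem. -/
theorem base_of_star [FrechetUrysohnSpace Y] [RegularSpace Y] {N : Set (Set Y)}
    (hN : PointCountableFam N)
    (star : ∀ (x : Y) (W : Set Y), IsOpen W → x ∈ W →
      ∃ F ⊆ N, F.Finite ∧ x ∈ interior (⋃₀ F) ∧ ⋃₀ F ⊆ W) :
    ∃ B : Set (Set Y), IsBaseFam B ∧ PointCountableFam B := by
  let mn : Set Y → Set (Set Y) → Prop := fun E F => F ⊆ N ∧ F.Finite ∧ E ⊆ interior (⋃₀ F) ∧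
      ∀ R ⊆ F, E ⊆ interior (⋃₀ R) → R = F
  let H : Set (Set Y) → Set (Set Y) := fun F =>
    {P ∈ N | closure P ⊆ interior (⋃₀ F) ∧ ∃ x ∈ closure P, mn {x} F}
  let V : Set (Set Y) → Set Y := fun F => interior (⋃₀ (H F))
  refine ⟨range V, ⟨?_, ?_⟩, ?_⟩
  · rintro _ ⟨F, rfl⟩; exact isOpen_interior
  · intro U hU x hx
    obtain ⟨F0, hF0N, hF0fin, hxF0, hF0U⟩ := star x U hU hx
    have hmin : ∃ F ⊆ F0, mn {x} F := by
      have hS : {R : Set (Set Y) | R ⊆ F0 ∧ x ∈ interior (⋃₀ R)}.Finite :=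
        hF0fin.finite_subsets.subset (fun R hR => hR.1)
      obtain ⟨F, hF⟩ := hS.exists_minimal ⟨F0, subset_rfl, hxF0⟩
      refine ⟨F, hF.1.1, hF.1.1.trans hF0N, hF0fin.subset hF.1.1,
        singleton_subset_iff.2 hF.1.2, ?_⟩
      intro R hR hxR
      exact subset_antisymm hR (hF.2 ⟨hR.trans hF.1.1, singleton_subset_iff.1 hxR⟩ hR)
    obtain ⟨F, hFF0, hm⟩ := hmin
    have hxF : x ∈ interior (⋃₀ F) := singleton_subset_iff.1 hm.2.2.1
    refine ⟨V F, mem_range_self F, ?_, ?_⟩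
    · obtain ⟨T, hT, hTc, hTs⟩ := exists_mem_nhds_isClosed_subset (isOpen_interior.mem_nhds hxF)
      obtain ⟨G, hGN, hGfin, hxG, hGT⟩ := star x (interior T) isOpen_interior
        (mem_interior_iff_mem_nhds.2 hT)
      rw [mem_interior_iff_mem_nhds] at hxG
      refine mem_interior_iff_mem_nhds.2 ?_
      have hfar : ∀ᶠ z in 𝓝 x, ∀ P ∈ G, x ∉ closure P → z ∉ closure P := by
        refine (hGfin.eventually_all (l := 𝓝 x)).2 ?_
        intro P hP
        by_cases h : x ∈ closure P
        · exact Eventually.of_forall (fun z h' => absurd h h')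
        · filter_upwards [isClosed_closure.isOpen_compl.mem_nhds h] with z hz _ using hz
      filter_upwards [hxG, hfar] with z hz hz2
      obtain ⟨P, hP, hzP⟩ := hz
      refine ⟨P, ⟨hGN hP, ?_, x, ?_, hm⟩, hzP⟩
      · exact (closure_minimal ((subset_sUnion_of_mem hP).trans (hGT.trans interior_subset))
          hTc).trans hTs
      · by_contra h
        exact hz2 P hP h (subset_closure hzP)
    · refine interior_subset.trans (sUnion_subset ?_)
      rintro P ⟨-, hP, -⟩
      exact subset_closure.trans (hP.trans (interior_subset.trans
        ((sUnion_subset_sUnion hFF0).trans hF0U)))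
  · intro y
    have : (⋃ P ∈ {P ∈ N | y ∈ P}, {F | mn (closure P) F}).Countable :=
      (hN y).biUnion (fun P _ => countable_minimal hN (closure P))
    refine (this.image V).mono ?_
    rintro _ ⟨⟨F, rfl⟩, hy⟩
    obtain ⟨P, ⟨hPN, hPF, x, hxP, hm⟩, hyP⟩ := interior_subset hy
    refine ⟨F, mem_biUnion (x := P) ⟨hPN, hyP⟩ ?_, rfl⟩
    exact ⟨hm.1, hm.2.1, hPF, fun R hR hPR => hm.2.2.2 R hR
      (singleton_subset_iff.2 (hPR hxP))⟩

/-- star condition from a k-network and a strong Fréchet property -/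
theorem star_of_knet [FrechetUrysohnSpace Y] {N : Set (Set Y)}
    (hN : PointCountableFam N) (hk : IsKNetwork N)
    (strong : ∀ (x : Y) (A : ℕ → Set Y), (¬ IsOpen ({x} : Set Y)) → (∀ n, x ∈ closure (A n)) →
      ∃ (a : ℕ → Y) (k : ℕ → ℕ), (∀ i, a i ∈ A (k i)) ∧ Tendsto a atTop (𝓝 x) ∧
        Tendsto k atTop atTop)
    (x : Y) (W : Set Y) (hW : IsOpen W) (hx : x ∈ W) :
    ∃ F ⊆ N, F.Finite ∧ x ∈ interior (⋃₀ F) ∧ ⋃₀ F ⊆ W := by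
  classical
  by_cases hiso : IsOpen ({x} : Set Y)
  · obtain ⟨F, hFN, hfin, h1, h2⟩ := hk {x} isCompact_singleton W hW (singleton_subset_iff.2 hx)
    exact ⟨F, hFN, hfin, interior_maximal h1 hiso rfl, h2⟩
  by_contra! hcon
  let N' : Set (Set Y) := {P ∈ N | P ⊆ W}
  have hN' : PointCountableFam N' := by
    intro y
    refine (hN y).mono ?_
    rintro P ⟨⟨h1, -⟩, h2⟩
    exact ⟨h1, h2⟩
  have key : ∀ R : Set (Set Y), ∃ C : Set Y, C.Countable ∧ (R ⊆ N' → R.Finite →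
      C ⊆ (⋃₀ R)ᶜ ∧ x ∈ closure C) := by
    intro R
    by_cases h : R ⊆ N' ∧ R.Finite
    · have h1 : x ∉ interior (⋃₀ R) := fun h' =>
        hcon R (fun P hP => (h.1 hP).1) h.2 h' (sUnion_subset (fun P hP => (h.1 hP).2))
      have : x ∈ closure (⋃₀ R)ᶜ := by rw [closure_compl]; exact h1
      obtain ⟨s, hs, hlim⟩ := mem_closure_iff_seq_limit.1 this
      exact ⟨range s, countable_range s, fun _ _ => ⟨range_subset_iff.2 hs,
        mem_closure_of_tendsto hlim (Eventually.of_forall mem_range_self)⟩⟩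
    · exact ⟨∅, countable_empty, fun h1 h2 => absurd ⟨h1, h2⟩ h⟩
  choose g hg hg2 using key
  obtain ⟨D, hD, hcl⟩ := closing hN' g hg
  have hcount := countable_meet hN' hD
  obtain ⟨p, hp⟩ := (hcount.insert ∅).exists_eq_range (insert_nonempty _ _)
  have hpF : ∀ n, ∃ R ⊆ {P ∈ N' | (D ∩ P).Nonempty}, R.Finite ∧
      ⋃₀ R = ⋃ i ∈ {i | i ≤ n}, p i := by
    intro n
    refine ⟨p '' {i | i ≤ n} \ {∅}, ?_, ((finite_le_nat n).image p).sdiff, ?_⟩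
    · rintro P ⟨⟨i, -, rfl⟩, hne⟩
      have : p i ∈ insert ∅ {P ∈ N' | (D ∩ P).Nonempty} := hp ▸ mem_range_self i
      exact this.resolve_left hne
    · rw [sUnion_sdiff_singleton_empty, sUnion_image]
  obtain ⟨a, k, ha, hlim, hk2⟩ := strong x (fun n => D \ ⋃ i ∈ {i | i ≤ n}, p i) hiso (by
    intro n
    obtain ⟨R, hR, hfin, hRe⟩ := hpF n
    obtain ⟨h1, h2⟩ := hg2 R (fun P hP => (hR hP).1) hfin
    refine closure_mono ?_ h2
    intro c hc
    exact ⟨hcl R hR hfin hc, hRe ▸ h1 hc⟩)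
  obtain ⟨m, hm⟩ := eventually_atTop.1 (hlim.eventually (hW.mem_nhds hx))
  have hlim' : Tendsto (fun i => a (i + m)) atTop (𝓝 x) := hlim.comp (tendsto_add_atTop_nat m)
  obtain ⟨F, hFN, hfin, h1, h2⟩ := hk _ hlim'.isCompact_insert_range W hW (by
    rw [insert_subset_iff, range_subset_iff]
    exact ⟨hx, fun i => hm _ (Nat.le_add_left _ _)⟩)
  have hev : ∀ᶠ i in atTop, ∀ P ∈ F, a (i + m) ∉ P := by
    refine hfin.eventually_all.2 ?_
    intro P hP
    by_cases h : ∃ i, a (i + m) ∈ P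
    · obtain ⟨i, hi⟩ := h
      have hPD : P ∈ range p := by
        rw [← hp]
        exact Or.inr ⟨⟨hFN hP, (subset_sUnion_of_mem hP).trans h2⟩, _, (ha (i + m)).1, hi⟩
      obtain ⟨j, rfl⟩ := hPD
      have := (hk2.comp (tendsto_add_atTop_nat m)).eventually_ge_atTop j
      filter_upwards [this] with l hl hal
      exact (ha (l + m)).2 (mem_biUnion (show j ∈ {i | i ≤ k (l + m)} from hl) hal)
    · push Not at h
      exact Eventually.of_forall h
  obtain ⟨i, hi⟩ := hev.exists
  obtain ⟨P, hP, haP⟩ := h1 (mem_insert_of_mem _ (mem_range_self i))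
  exact hi P hP haP

theorem knet_of_inducing {Z : Type*} [TopologicalSpace Z] {f : Y → Z} (hf : IsInducing f)
    (h : ∃ N : Set (Set Z), PointCountableFam N ∧ IsKNetwork N) :
    ∃ N : Set (Set Y), PointCountableFam N ∧ IsKNetwork N := by
  obtain ⟨N, hN, hk⟩ := h
  refine ⟨(fun P => f ⁻¹' P) '' N, ?_, ?_⟩
  · intro y
    refine ((hN (f y)).image (fun P => f ⁻¹' P)).mono ?_
    rintro _ ⟨⟨P, hP, rfl⟩, hy⟩
    exact ⟨P, ⟨hP, hy⟩, rfl⟩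
  · intro C hC U hU hCU
    obtain ⟨U', hU', rfl⟩ := hf.isOpen_iff.1 hU
    obtain ⟨Q, hQ, hfin, h1, h2⟩ := hk (f '' C) (hC.image hf.continuous) U' hU'
      (image_subset_iff.2 hCU)
    refine ⟨(fun P => f ⁻¹' P) '' Q, image_mono hQ, hfin.image _, ?_, ?_⟩
    · intro c hc
      obtain ⟨P, hP, hcP⟩ := h1 (mem_image_of_mem f hc)
      exact ⟨_, ⟨P, hP, rfl⟩, hcP⟩
    · rintro c ⟨_, ⟨P, hP, rfl⟩, hc⟩
      exact h2 ⟨P, hP, hc⟩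

theorem knet_of_base {B : Set (Set Y)} (hB : IsBaseFam B) : IsKNetwork B := by
  intro C hC U hU hCU
  have : ∀ y ∈ C, ∃ P ∈ B, y ∈ P ∧ P ⊆ U := fun y hy => hB.2 U hU y (hCU hy)
  choose! p hp1 hp2 hp3 using this
  obtain ⟨t, ht, hcov⟩ := hC.elim_nhds_subcover p
      (fun y hy => (hB.1 _ (hp1 y hy)).mem_nhds (hp2 y hy))
  refine ⟨p '' (t : Set Y), ?_, t.finite_toSet.image p, ?_, ?_⟩
  · rintro _ ⟨y, hy, rfl⟩; exact hp1 y (ht y hy)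
  · rw [sUnion_image]; exact hcov
  · rw [sUnion_image]; exact iUnion₂_subset (fun y hy => hp3 y (ht y hy))

theorem firstCountable_of_base {B : Set (Set Y)} (hB : IsBaseFam B) (hN : PointCountableFam B) :
    FirstCountableTopology Y := by
  refine ⟨fun y => ?_⟩
  have : (𝓝 y).HasBasis (fun P : Set Y => P ∈ {P ∈ B | y ∈ P}) id := by
    refine ⟨fun t => ⟨fun ht => ?_, ?_⟩⟩
    · obtain ⟨U, hUt, hU, hy⟩ := mem_nhds_iff.1 ht
      obtain ⟨P, hP, hyP, hPU⟩ := hB.2 U hU y hy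
      exact ⟨P, ⟨hP, hyP⟩, hPU.trans hUt⟩
    · rintro ⟨P, ⟨hP, hyP⟩, hPt⟩
      exact mem_of_superset ((hB.1 P hP).mem_nhds hyP) hPt
  exact HasCountableBasis.isCountablyGenerated ⟨this, hN y⟩

theorem weakBase_of_base {B : Set (Set Y)} (hB : IsBaseFam B) :
    IsWeakBase (fun y => {P ∈ B | y ∈ P}) := by
  refine ⟨fun y P hP => hP.2, ?_, ?_, ?_⟩
  · rintro y U ⟨hU, hyU⟩ V ⟨hV, hyV⟩
    obtain ⟨P, hP, hyP, hPU⟩ := hB.2 (U ∩ V) ((hB.1 U hU).inter (hB.1 V hV)) y ⟨hyU, hyV⟩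
    exact ⟨P, ⟨hP, hyP⟩, hPU⟩
  · intro y U hU hy
    obtain ⟨P, hP, hyP, hPU⟩ := hB.2 U hU y hy
    exact ⟨P, ⟨hP, hyP⟩, hPU⟩
  · intro G hG
    refine isOpen_iff_mem_nhds.2 fun y hy => ?_
    obtain ⟨P, ⟨hP, hyP⟩, hPG⟩ := hG y hy
    exact mem_of_superset ((hB.1 P hP).mem_nhds hyP) hPG

theorem wb_eventually [T2Space Y] {W : Y → Set (Set Y)} (hW : IsWeakBase W) {y : Y} {P : Set Y}
    (hP : P ∈ W y) {z : ℕ → Y} (hz : Tendsto z atTop (𝓝 y)) : ∀ᶠ n in atTop, z n ∈ P := by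
  by_contra hcon
  have hfr : ∃ᶠ n in atTop, z n ∉ P := not_eventually.1 hcon
  obtain ⟨φ, hφ, hφP⟩ := extraction_of_frequently_atTop hfr
  have hlim : Tendsto (z ∘ φ) atTop (𝓝 y) := hz.comp hφ.tendsto_atTop
  have hcl : IsClosed (insert y (range (z ∘ φ))) := hlim.isCompact_insert_range.isClosed
  have hopen : IsOpen (range (z ∘ φ))ᶜ := by
    refine hW.2.2.2 _ ?_
    intro w hw
    by_cases h : w = y
    · subst h
      refine ⟨P, hP, ?_⟩
      rintro q hq ⟨n, rfl⟩
      exact hφP n hq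
    · obtain ⟨Q, hQ, hQs⟩ := hW.2.2.1 w _ hcl.isOpen_compl (by
        rintro (h' | h')
        · exact h h'
        · exact hw h')
      exact ⟨Q, hQ, hQs.trans (compl_subset_compl.2 (subset_insert _ _))⟩
  have hy : y ∈ (range (z ∘ φ))ᶜ := by
    rintro ⟨n, hn⟩
    have hn' : z (φ n) = y := hn
    exact hφP n (hn' ▸ hW.1 y P hP)
  obtain ⟨n, hn⟩ := (hlim.eventually (hopen.mem_nhds hy)).exists
  exact hn (mem_range_self n)

theorem wb_seq {W : Y → Set (Set Y)} (hW : IsWeakBase W) {y : Y} (hc : (W y).Countable) :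
    ∃ Q : ℕ → Set Y, (∀ n, Q n ∈ W y) ∧
      ∀ z : ℕ → Y, (∀ n, z n ∈ Q n) → Tendsto z atTop (𝓝 y) := by
  obtain ⟨P0, hP0, -⟩ := hW.2.2.1 y univ isOpen_univ trivial
  obtain ⟨p, hp⟩ := hc.exists_eq_range ⟨P0, hP0⟩
  have hpm : ∀ n, p n ∈ W y := fun n => hp ▸ mem_range_self n
  have hdir := hW.2.1 y
  choose! d hd1 hd2 using hdir
  let Q : ℕ → Set Y := fun n => Nat.rec (p 0) (fun n q => d q (p (n + 1))) n
  have hQ : ∀ n, Q n ∈ W y := by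
    intro n
    induction n with
    | zero => exact hpm 0
    | succ n ih => exact hd1 _ ih _ (hpm (n + 1))
  have hanti : Antitone Q := antitone_nat_of_succ_le (fun n =>
    (hd2 (Q n) (hQ n) _ (hpm (n + 1))).trans inter_subset_left)
  have hQp : ∀ n, Q n ⊆ p n := by
    intro n
    cases n with
    | zero => exact subset_rfl
    | succ n => exact (hd2 (Q n) (hQ n) _ (hpm (n + 1))).trans inter_subset_right
  refine ⟨Q, hQ, fun z hz => ?_⟩
  refine tendsto_nhds.2 fun U hU hy => ?_
  obtain ⟨P, hP, hPU⟩ := hW.2.2.1 y U hU hy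
  rw [hp] at hP
  obtain ⟨k, rfl⟩ := hP
  filter_upwards [eventually_ge_atTop k] with n hn
  exact hPU (hQp k (hanti hn (hz n)))

theorem wb_closed {W : Y → Set (Set Y)} (hW : IsWeakBase W) (hc : ∀ y, (W y).Countable)
    {F : Set Y} (hF : IsSeqClosed F) : IsClosed F := by
  refine ⟨hW.2.2.2 _ fun y hy => ?_⟩
  by_contra! hcon
  obtain ⟨Q, hQ, hlim⟩ := wb_seq hW (hc y)
  have : ∀ n, ∃ z ∈ Q n, z ∈ F := by
    intro n
    obtain ⟨z, hz, hzF⟩ := not_subset.1 (hcon (Q n) (hQ n))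
    exact ⟨z, hz, not_not.1 hzF⟩
  choose z hz hzF using this
  exact hy (hF hzF (hlim z hz))

theorem base_of_wb [T2Space Y] [FrechetUrysohnSpace Y] {W : Y → Set (Set Y)} (hW : IsWeakBase W)
    (hc : PointCountableFam (⋃ y, W y)) :
    ∃ B : Set (Set Y), IsBaseFam B ∧ PointCountableFam B := by
  refine ⟨interior '' (⋃ y, W y), ⟨?_, ?_⟩, ?_⟩
  · rintro _ ⟨P, -, rfl⟩; exact isOpen_interior
  · intro U hU y hy
    obtain ⟨P, hP, hPU⟩ := hW.2.2.1 y U hU hy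
    refine ⟨interior P, ⟨P, mem_iUnion.2 ⟨y, hP⟩, rfl⟩, ?_, interior_subset.trans hPU⟩
    by_contra h
    have : y ∈ closure Pᶜ := by rw [closure_compl]; exact h
    obtain ⟨s, hs, hlim⟩ := mem_closure_iff_seq_limit.1 this
    obtain ⟨n, hn⟩ := (wb_eventually hW hP hlim).exists
    exact hs n hn
  · intro y
    refine ((hc y).image interior).mono ?_
    rintro _ ⟨⟨P, hP, rfl⟩, hy⟩
    exact ⟨P, ⟨hP, interior_subset hy⟩, rfl⟩

end Helpers

section Hyper

open Filter Topology

universe u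
variable {X : Type u} [TopologicalSpace X]

theorem VHyper.ext' {A B : VHyper X} (h : A.carrier = B.carrier) : A = B := by
  cases A; cases B; cases h; rfl

theorem isOpen_vbox {Ps : Finset (Set X)} (h : ∀ U ∈ Ps, IsOpen U) :
    IsOpen (VHyper.vbox Ps) := TopologicalSpace.isOpen_generateFrom_of_mem ⟨Ps, h, rfl⟩

theorem isOpen_sub {U : Set X} (hU : IsOpen U) : IsOpen {A : VHyper X | A.carrier ⊆ U} := by
  classical
  have : {A : VHyper X | A.carrier ⊆ U} = VHyper.vbox {U} := by
    ext A
    constructor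
    · intro h
      have h : A.carrier ⊆ U := h
      refine ⟨by simpa using h, ?_⟩
      intro P hP
      rw [Finset.mem_singleton] at hP
      subst hP
      rw [inter_eq_left.2 h]
      exact A.nonempty'
    · rintro ⟨h, -⟩
      simpa using h
  rw [this]
  exact isOpen_vbox (by simpa using hU)

theorem isOpen_meet {U : Set X} (hU : IsOpen U) :
    IsOpen {A : VHyper X | (A.carrier ∩ U).Nonempty} := by
  classical
  have : {A : VHyper X | (A.carrier ∩ U).Nonempty} = VHyper.vbox {univ, U} := by
    ext A
    constructor
    · intro h
      have h : (A.carrier ∩ U).Nonempty := h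
      refine ⟨by simp, ?_⟩
      intro P hP
      rw [Finset.mem_insert, Finset.mem_singleton] at hP
      rcases hP with rfl | rfl
      · rw [inter_univ]; exact A.nonempty'
      · exact h
    · rintro ⟨-, h⟩
      exact h U (by simp)
  rw [this]
  refine isOpen_vbox ?_
  intro V hV
  rw [Finset.mem_insert, Finset.mem_singleton] at hV
  rcases hV with rfl | rfl
  · exact isOpen_univ
  · exact hU

theorem VHyper.separate [T2Space X] {K L : VHyper X} (h : ¬ K.carrier ⊆ L.carrier) :
    ∃ u v : Set (VHyper X), IsOpen u ∧ IsOpen v ∧ K ∈ u ∧ L ∈ v ∧ Disjoint u v := by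
  obtain ⟨x, hxK, hxL⟩ := not_subset.1 h
  obtain ⟨U, V, hU, hV, hxU, hLV, hd⟩ := SeparatedNhds.of_isCompact_isCompact
    (isCompact_singleton (x := x)) L.isCompact' (disjoint_singleton_left.2 hxL)
  refine ⟨_, _, isOpen_meet hU, isOpen_sub hV, ⟨x, hxK, hxU rfl⟩, hLV, ?_⟩
  rw [Set.disjoint_left]
  rintro A ⟨a, haA, haU⟩ hAV
  exact Set.disjoint_left.1 hd haU (hAV haA)

instance [T2Space X] : T2Space (VHyper X) := by
  refine ⟨fun K L hne => ?_⟩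
  by_cases h : K.carrier ⊆ L.carrier
  · have h' : ¬ L.carrier ⊆ K.carrier := fun h' => hne (VHyper.ext' (subset_antisymm h h'))
    obtain ⟨u, v, hu, hv, h1, h2, hd⟩ := VHyper.separate h'
    exact ⟨v, u, hv, hu, h2, h1, hd.symm⟩
  · exact VHyper.separate h

/-- the pair `{z, a}` -/
def vpair (z a : X) : VHyper X := ⟨{z, a}, (Set.toFinite _).isCompact, insert_nonempty _ _⟩

/-- the pair `{z, a}` in `ℱ₂(X)` -/
def vpair2 (z a : X) : VFin2 X := ⟨vpair z a, by
  refine (Set.encard_insert_le {a} z).trans ?_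
  rw [Set.encard_singleton]
  exact le_of_eq one_add_one_eq_two⟩

theorem continuous_vpair : Continuous (fun q : X × X => vpair q.1 q.2) := by
  refine continuous_generateFrom_iff.2 ?_
  rintro _ ⟨Ps, hPs, rfl⟩
  have : (fun q : X × X => vpair q.1 q.2) ⁻¹' VHyper.vbox Ps =
      (Prod.fst ⁻¹' (⋃₀ (Ps : Set (Set X))) ∩ Prod.snd ⁻¹' (⋃₀ (Ps : Set (Set X)))) ∩
        ⋂ P ∈ Ps, (Prod.fst ⁻¹' P ∪ Prod.snd ⁻¹' P) := by
    ext ⟨z, a⟩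
    have h1 : ∀ P : Set X, (({z, a} : Set X) ∩ P).Nonempty ↔ z ∈ P ∨ a ∈ P := by
      intro P
      constructor
      · rintro ⟨b, rfl | rfl, hb⟩
        · exact Or.inl hb
        · exact Or.inr hb
      · rintro (h | h)
        · exact ⟨z, Or.inl rfl, h⟩
        · exact ⟨a, Or.inr rfl, h⟩
    change (({z, a} : Set X) ⊆ _ ∧ ∀ P ∈ Ps, (({z, a} : Set X) ∩ P).Nonempty) ↔ _
    simp only [h1, insert_subset_iff, singleton_subset_iff, mem_inter_iff, mem_preimage,
      mem_iInter, mem_union]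
  rw [this]
  have hU : IsOpen (⋃₀ (Ps : Set (Set X))) := isOpen_sUnion (fun P hP => hPs P hP)
  refine ((hU.preimage continuous_fst).inter (hU.preimage continuous_snd)).inter ?_
  exact isOpen_biInter_finset (fun P hP => ((hPs P hP).preimage continuous_fst).union
    ((hPs P hP).preimage continuous_snd))

theorem inducing_val2 : IsInducing (fun A : VFin2 X => (A.1 : VHyper X)) :=
  IsInducing.subtypeVal (t := {A : VHyper X | A.carrier.encard ≤ 2})

theorem continuous_vpair2 : Continuous (fun q : X × X => vpair2 q.1 q.2) :=
  inducing_val2.continuous_iff.2 continuous_vpair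

theorem continuous_sing : Continuous (fun x : X => vpair x x) :=
  continuous_vpair.comp (continuous_id.prodMk continuous_id)

theorem inducing_sing : IsInducing (fun x : X => vpair x x) := by
  refine ⟨le_antisymm continuous_sing.le_induced ?_⟩
  intro U hU
  refine isOpen_induced_iff.2 ⟨_, isOpen_sub hU, ?_⟩
  ext x
  change ({x, x} : Set X) ⊆ U ↔ x ∈ U
  simp

theorem inducing_sing2 : IsInducing (fun x : X => vpair2 x x) :=
  (inducing_val2.of_comp_iff (f := fun x : X => vpair2 x x)).1 inducing_sing

theorem strong_of_fin2 [T2Space X] [FrechetUrysohnSpace (VFin2 X)] [FrechetUrysohnSpace X]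
    (x : X) (A : ℕ → Set X) (hiso : ¬ IsOpen ({x} : Set X)) (hA : ∀ n, x ∈ closure (A n)) :
      ∃ (a : ℕ → X) (k : ℕ → ℕ), (∀ i, a i ∈ A (k i)) ∧ Tendsto a atTop (𝓝 x) ∧
        Tendsto k atTop atTop := by
  have hx : x ∈ closure ({x}ᶜ : Set X) := by
    rw [closure_compl]
    intro h
    apply hiso
    rw [isOpen_iff_mem_nhds]
    rintro y rfl
    exact mem_interior_iff_mem_nhds.1 h
  obtain ⟨z, hz, hzlim⟩ := mem_closure_iff_seq_limit.1 hx
  let S : Set (VFin2 X) := {s | ∃ n, ∃ a ∈ A n, s = vpair2 (z n) a}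
  have hS : vpair2 x x ∈ closure S := by
    refine mem_closure_iff_nhds.2 fun O hO => ?_
    have h1 : (fun q : X × X => vpair2 q.1 q.2) ⁻¹' O ∈ 𝓝 (x, x) :=
      continuous_vpair2.continuousAt.preimage_mem_nhds hO
    obtain ⟨U, hU, V, hV, hUV⟩ := mem_nhds_prod_iff.1 h1
    obtain ⟨n, hn⟩ := (hzlim.eventually hU).exists
    obtain ⟨a, haV, haA⟩ := mem_closure_iff_nhds.1 (hA n) V hV
    exact ⟨vpair2 (z n) a, hUV (mk_mem_prod hn haV), n, a, haA, rfl⟩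
  obtain ⟨s, hs, hslim⟩ := mem_closure_iff_seq_limit.1 hS
  choose k a ha hsa using hs
  have hev : ∀ U : Set X, IsOpen U → x ∈ U → ∀ᶠ i in atTop, z (k i) ∈ U ∧ a i ∈ U := by
    intro U hU hxU
    have h1 := (inducing_val2.continuous.tendsto _).comp hslim
    filter_upwards [h1.eventually ((isOpen_sub hU).mem_nhds (by
      change ({x, x} : Set X) ⊆ U
      simpa using hxU))] with i hi
    have hi : (s i).1.carrier ⊆ U := hi
    rw [hsa i] at hi
    exact ⟨hi (Or.inl rfl), hi (Or.inr rfl)⟩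
  refine ⟨a, k, ha, tendsto_nhds.2 fun U hU hxU => ?_, ?_⟩
  · filter_upwards [hev U hU hxU] with i hi using hi.2
  · refine tendsto_atTop.2 fun b => ?_
    have hfin : (z '' {i | i ≤ b}).Finite := (finite_le_nat b).image z
    filter_upwards [hev _ hfin.isClosed.isOpen_compl (by
      rintro ⟨i, -, hi⟩
      exact hz i hi)] with i hi
    by_contra h
    exact hi.1 ⟨k i, (not_le.1 h).le, rfl⟩

theorem two_one [T2Space X] [RegularSpace X] (h : FrechetUrysohnSpace (VFin2 X) ∧
         ∃ N : Set (Set (VFin2 X)), PointCountableFam N ∧ IsKNetwork N) :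
    ∃ B : Set (Set X), IsBaseFam B ∧ PointCountableFam B := by
  haveI := h.1
  haveI : FrechetUrysohnSpace X := inducing_sing2.frechetUrysohnSpace
  obtain ⟨N, hN, hk⟩ := knet_of_inducing inducing_sing2 h.2
  exact base_of_star hN (star_of_knet hN hk strong_of_fin2)

theorem refine_box {B : Set (Set X)} (hB : IsBaseFam B) (K : VHyper X) (U : Set X)
    (hU : IsOpen U) (hKU : K.carrier ⊆ U) (Vs : Finset (Set X)) (hVo : ∀ V ∈ Vs, IsOpen V)
    (hV : ∀ V ∈ Vs, (K.carrier ∩ V).Nonempty) :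
    ∃ Rs : Finset (Set X), ↑Rs ⊆ B ∧ K ∈ VHyper.vbox Rs ∧
      ∀ A ∈ VHyper.vbox Rs, A.carrier ⊆ U ∧ ∀ V ∈ Vs, (A.carrier ∩ V).Nonempty := by
  classical
  have h1 : ∀ y ∈ K.carrier, ∃ P ∈ B, y ∈ P ∧ P ⊆ U := fun y hy => hB.2 U hU y (hKU hy)
  choose! p hp1 hp2 hp3 using h1
  obtain ⟨t, ht, hcov⟩ := K.isCompact'.elim_nhds_subcover p
      (fun y hy => (hB.1 _ (hp1 y hy)).mem_nhds (hp2 y hy))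
  have h2 : ∀ V ∈ Vs, ∃ P ∈ B, (K.carrier ∩ P).Nonempty ∧ P ⊆ U ∩ V := by
    intro V hVV
    obtain ⟨y, hyK, hyV⟩ := hV V hVV
    obtain ⟨P, hP, hyP, hPs⟩ := hB.2 (U ∩ V) (hU.inter (hVo V hVV)) y ⟨hKU hyK, hyV⟩
    exact ⟨P, hP, ⟨y, hyK, hyP⟩, hPs⟩
  choose! q hq1 hq2 hq3 using h2
  have hmem : ∀ P, P ∈ t.image p ∪ Vs.image q →
      P ∈ B ∧ (K.carrier ∩ P).Nonempty ∧ P ⊆ U := by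
    intro P hP
    rw [Finset.mem_union, Finset.mem_image, Finset.mem_image] at hP
    rcases hP with ⟨y, hy, rfl⟩ | ⟨V, hVV, rfl⟩
    · exact ⟨hp1 y (ht y hy), ⟨y, ht y hy, hp2 y (ht y hy)⟩, hp3 y (ht y hy)⟩
    · exact ⟨hq1 V hVV, hq2 V hVV, (hq3 V hVV).trans inter_subset_left⟩
  refine ⟨t.image p ∪ Vs.image q, fun P hP => (hmem P hP).1, ⟨?_, fun P hP => (hmem P hP).2.1⟩,
    ?_⟩
  · intro y hy
    obtain ⟨x, hx, hyx⟩ := mem_iUnion₂.1 (hcov hy)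
    exact ⟨p x, Finset.mem_coe.2 (Finset.mem_union_left _ (Finset.mem_image_of_mem p hx)), hyx⟩
  · rintro A ⟨hA1, hA2⟩
    refine ⟨hA1.trans (sUnion_subset fun P hP => (hmem P hP).2.2), ?_⟩
    intro V hVV
    exact (hA2 (q V) (Finset.mem_union_right _ (Finset.mem_image_of_mem q hVV))).mono
      (inter_subset_inter_right _ ((hq3 V hVV).trans inter_subset_right))

theorem one_six [T2Space X] (h : ∃ B : Set (Set X), IsBaseFam B ∧ PointCountableFam B) :
    ∃ B : Set (Set (VHyper X)), IsBaseFam B ∧ PointCountableFam B := by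
  classical
  obtain ⟨B, hB, hN⟩ := h
  refine ⟨{S | ∃ Ps : Finset (Set X), ↑Ps ⊆ B ∧ S = VHyper.vbox Ps}, ⟨?_, ?_⟩, ?_⟩
  · rintro _ ⟨Ps, hPs, rfl⟩
    exact isOpen_vbox (fun U hU => hB.1 U (hPs hU))
  · intro O hO K hK
    suffices h : ∃ Ps : Finset (Set X), ↑Ps ⊆ B ∧ K ∈ VHyper.vbox Ps ∧ VHyper.vbox Ps ⊆ O by
      obtain ⟨Ps, h1, h2, h3⟩ := h
      exact ⟨_, ⟨Ps, h1, rfl⟩, h2, h3⟩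
    induction hO with
    | basic s hs =>
      obtain ⟨Us, hUs, rfl⟩ := hs
      obtain ⟨Rs, h1, h2, h3⟩ := refine_box hB K (⋃₀ (Us : Set (Set X)))
        (isOpen_sUnion (fun P hP => hUs P hP)) hK.1 Us hUs hK.2
      exact ⟨Rs, h1, h2, fun A hA => h3 A hA⟩
    | univ =>
      obtain ⟨Rs, h1, h2, h3⟩ := refine_box hB K univ isOpen_univ (subset_univ _) ∅
        (by simp) (by simp)
      exact ⟨Rs, h1, h2, subset_univ _⟩
    | inter s t _ _ ihs iht =>
      obtain ⟨P, hP1, hP2, hP3⟩ := ihs hK.1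
      obtain ⟨Q, hQ1, hQ2, hQ3⟩ := iht hK.2
      have ho : ∀ U ∈ P ∪ Q, IsOpen U := by
        intro U hU
        rcases Finset.mem_union.1 hU with h | h
        · exact hB.1 U (hP1 h)
        · exact hB.1 U (hQ1 h)
      obtain ⟨Rs, h1, h2, h3⟩ := refine_box hB K
        (⋃₀ (P : Set (Set X)) ∩ ⋃₀ (Q : Set (Set X)))
        ((isOpen_sUnion fun U hU => hB.1 U (hP1 hU)).inter
          (isOpen_sUnion fun U hU => hB.1 U (hQ1 hU)))
        (subset_inter hP2.1 hQ2.1) (P ∪ Q) ho (by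
          intro U hU
          rcases Finset.mem_union.1 hU with h | h
          · exact hP2.2 U h
          · exact hQ2.2 U h)
      refine ⟨Rs, h1, h2, fun A hA => ⟨hP3 ⟨?_, ?_⟩, hQ3 ⟨?_, ?_⟩⟩⟩
      · exact (h3 A hA).1.trans inter_subset_left
      · exact fun U hU => (h3 A hA).2 U (Finset.mem_union_left _ hU)
      · exact (h3 A hA).1.trans inter_subset_right
      · exact fun U hU => (h3 A hA).2 U (Finset.mem_union_right _ hU)
    | sUnion S _ ih =>
      obtain ⟨s, hs, hKs⟩ := hK
      obtain ⟨Ps, h1, h2, h3⟩ := ih s hs hKs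
      exact ⟨Ps, h1, h2, h3.trans (subset_sUnion_of_mem hs)⟩
  · intro K
    have hc := compactCountable_of_base hB hN K.carrier K.isCompact'
    have hc2 := (countable_ofPred_finite_subset hc).image
      (fun F : Set (Set X) => if h : F.Finite then VHyper.vbox h.toFinset else ∅)
    refine hc2.mono ?_
    rintro _ ⟨⟨Ps, hPs, rfl⟩, hK⟩
    refine ⟨(Ps : Set (Set X)), ⟨Ps.finite_toSet, fun P hP => ⟨hPs hP, hK.2 P hP⟩⟩, ?_⟩
    dsimp only
    rw [dif_pos Ps.finite_toSet, Finset.finite_toSet_toFinset]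

theorem wb_sing [T2Space X] {W : VHyper X → Set (Set (VHyper X))} (hW : IsWeakBase W) :
    IsWeakBase (fun x : X => (fun P => (fun x : X => vpair x x) ⁻¹' P) '' W (vpair x x)) := by
  refine ⟨?_, ?_, ?_, ?_⟩
  · rintro x _ ⟨P, hP, rfl⟩
    exact hW.1 _ P hP
  · rintro x _ ⟨P, hP, rfl⟩ _ ⟨Q, hQ, rfl⟩
    obtain ⟨R, hR, hRs⟩ := hW.2.1 _ P hP Q hQ
    exact ⟨_, ⟨R, hR, rfl⟩, fun y hy => hRs hy⟩
  · intro x U hU hx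
    obtain ⟨P, hP, hPs⟩ := hW.2.2.1 (vpair x x) _ (isOpen_sub hU) (by
      change ({x, x} : Set X) ⊆ U
      simpa using hx)
    exact ⟨_, ⟨P, hP, rfl⟩, fun y hy => hPs hy (Or.inl rfl)⟩
  · intro G hG
    have hopen : IsOpen {A : VHyper X | ∀ x, A = vpair x x → x ∈ G} := by
      refine hW.2.2.2 _ ?_
      intro A hA
      by_cases hs : ∃ x, A = vpair x x
      · obtain ⟨x, rfl⟩ := hs
        obtain ⟨_, ⟨P, hP, rfl⟩, hPG⟩ := hG x (hA x rfl)
        refine ⟨P, hP, ?_⟩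
        rintro _ hB z rfl
        exact hPG hB
      · obtain ⟨a, ha⟩ := A.nonempty'
        have : ∃ b ∈ A.carrier, a ≠ b := by
          by_contra! hcon
          refine hs ⟨a, VHyper.ext' ?_⟩
          change A.carrier = {a, a}
          rw [pair_eq_singleton]
          exact subset_antisymm (fun b hb => (hcon b hb).symm) (singleton_subset_iff.2 ha)
        obtain ⟨b, hb, hab⟩ := this
        obtain ⟨U, V, hU, hV, haU, hbV, hd⟩ := t2_separation hab
        obtain ⟨P, hP, hPs⟩ := hW.2.2.1 A _ ((isOpen_meet hU).inter (isOpen_meet hV))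
          ⟨⟨a, ha, haU⟩, ⟨b, hb, hbV⟩⟩
        refine ⟨P, hP, ?_⟩
        rintro _ hB z rfl
        exfalso
        obtain ⟨⟨c, hc, hcU⟩, ⟨e, he, heV⟩⟩ := hPs hB
        have hc' : c = z := by
          have : c ∈ ({z, z} : Set X) := hc
          simpa using this
        have he' : e = z := by
          have : e ∈ ({z, z} : Set X) := he
          simpa using this
        subst hc'
        subst he'
        exact Set.disjoint_left.1 hd hcU heV
    have h2 := hopen.preimage continuous_sing
    convert h2 using 1
    ext x
    constructor
    · intro hx z hz
      have h3 : ({x, x} : Set X) = {z, z} := congrArg VHyper.carrier hz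
      have h4 : x = z := by simpa using h3
      exact h4 ▸ hx
    · intro h
      exact h x rfl

theorem tendsto_insert (K : VHyper X) (y : ℕ → X) (x : X) (hx : x ∈ K.carrier)
    (hy : Tendsto y atTop (𝓝 x)) :
    Tendsto (fun m => (⟨insert (y m) K.carrier, K.isCompact'.insert _, insert_nonempty _ _⟩ :
      VHyper X)) atTop (𝓝 K) := by
  refine TopologicalSpace.tendsto_nhds_generateFrom_iff.2 ?_
  rintro _ ⟨Ps, hPs, rfl⟩ hK
  have hU : IsOpen (⋃₀ (Ps : Set (Set X))) := isOpen_sUnion (fun P hP => hPs P hP)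
  filter_upwards [hy.eventually (hU.mem_nhds (hK.1 hx))] with m hm
  exact ⟨insert_subset hm hK.1, fun P hP => (hK.2 P hP).mono
    (inter_subset_inter_left _ (subset_insert _ _))⟩

theorem four_one [T2Space X] (h : ∃ W : VHyper X → Set (Set (VHyper X)), IsWeakBase W ∧
    PointCountableFam (⋃ K, W K)) :
    ∃ B : Set (Set X), IsBaseFam B ∧ PointCountableFam B := by
  obtain ⟨W, hW, hN⟩ := h
  have hWc : ∀ K, (W K).Countable := by
    intro K
    refine (hN K).mono ?_
    intro P hP
    exact ⟨mem_iUnion.2 ⟨K, hP⟩, hW.1 K P hP⟩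
  have hW1 := wb_sing hW
  have hFU : FrechetUrysohnSpace X := by
    refine ⟨fun A => ?_⟩
    have hcl : IsClosed (seqClosure A) := by
      refine wb_closed hW1 (fun x => (hWc _).image _) ?_
      intro xs x hxs hlim
      by_contra hx
      have hne : ∀ n, xs n ≠ x := fun n h => hx (h ▸ hxs n)
      choose s hs hslim using hxs
      have hsep : ∀ j, ∃ V V' : Set X, IsOpen V ∧ IsOpen V' ∧ xs j ∈ V ∧ x ∈ V' ∧
        Disjoint V V' := fun j => t2_separation (hne j)
      choose V V' hV hV' hxV hxV' hd using hsep
      let K : VHyper X := ⟨insert x (range xs), hlim.isCompact_insert_range, insert_nonempty _ _⟩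
      obtain ⟨Q, hQ, hQlim⟩ := wb_seq hW (hWc K)
      have hpick : ∀ n, ∃ m, (⟨insert (s n m) K.carrier, K.isCompact'.insert _,
          insert_nonempty _ _⟩ : VHyper X) ∈ Q n ∧ ∀ j ≤ n, xs n ∈ V' j → s n m ∈ V' j := by
        intro n
        have h1 := wb_eventually hW (hQ n)
          (tendsto_insert K (s n) (xs n) (mem_insert_of_mem _ (mem_range_self n)) (hslim n))
        have h2 : ∀ᶠ m in atTop, ∀ j ∈ {j | j ≤ n}, xs n ∈ V' j → s n m ∈ V' j := by
          refine (finite_le_nat n).eventually_all.2 ?_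
          intro j _
          by_cases h : xs n ∈ V' j
          · filter_upwards [(hslim n).eventually ((hV' j).mem_nhds h)] with m hm _ using hm
          · exact Eventually.of_forall (fun m h' => absurd h' h)
        exact (h1.and h2).exists
      choose m hmQ hmV using hpick
      have hKlim := hQlim _ hmQ
      refine hx ⟨fun n => s n (m n), fun n => hs n (m n), tendsto_nhds.2 fun U hU hxU => ?_⟩
      obtain ⟨J, hJ⟩ := eventually_atTop.1 (hlim.eventually (hU.mem_nhds hxU))
      have hO : IsOpen (U ∪ ⋃ j ∈ {j | j < J}, V j) :=
        hU.union (isOpen_biUnion fun j _ => hV j)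
      have e1 := hKlim.eventually ((isOpen_sub hO).mem_nhds (by
        change insert x (range xs) ⊆ _
        refine insert_subset (Or.inl hxU) ?_
        rintro _ ⟨j, rfl⟩
        by_cases h : j < J
        · exact Or.inr (mem_biUnion (show j ∈ {j | j < J} from h) (hxV j))
        · exact Or.inl (hJ j (not_lt.1 h))))
      have e2 : ∀ᶠ n in atTop, ∀ j ∈ {j | j < J}, s n (m n) ∉ V j := by
        refine (finite_lt_nat J).eventually_all.2 ?_
        intro j _
        filter_upwards [hlim.eventually ((hV' j).mem_nhds (hxV' j)), eventually_ge_atTop j]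
          with n hn hjn h
        exact Set.disjoint_left.1 (hd j) h (hmV n j hjn hn)
      filter_upwards [e1, e2] with n h1 h2
      have h1 : insert (s n (m n)) K.carrier ⊆ U ∪ ⋃ j ∈ {j | j < J}, V j := h1
      rcases h1 (mem_insert _ _) with h | h
      · exact h
      · obtain ⟨j, hj, hjV⟩ := mem_iUnion₂.1 h
        exact absurd hjV (h2 j hj)
    exact closure_minimal subset_seqClosure hcl
  refine base_of_wb hW1 ?_
  intro x
  refine ((hN (vpair x x)).image (fun P => (fun x : X => vpair x x) ⁻¹' P)).mono ?_
  rintro R ⟨hR, hxR⟩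
  obtain ⟨y, P, hP, rfl⟩ := mem_iUnion.1 hR
  exact ⟨P, ⟨mem_iUnion.2 ⟨_, hP⟩, hxR⟩, rfl⟩

end Hyper

/-- TFAE: `X` has a point-countable base; `ℱ₂(X)` is Fréchet–Urysohn with a point-countable
k-network; `𝒦(X)` is Fréchet–Urysohn with a point-countable k-network; `𝒦(X)` has a
point-countable weak base; `𝒦(X)` has a compact-countable weak base; `𝒦(X)` has a
point-countable base. -/
theorem statement8 {X : Type*} [TopologicalSpace X] [T2Space X] [RegularSpace X] :
    List.TFAE
      [∃ B : Set (Set X), IsBaseFam B ∧ PointCountableFam B,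
       FrechetUrysohnSpace (VFin2 X) ∧
         ∃ N : Set (Set (VFin2 X)), PointCountableFam N ∧ IsKNetwork N,
       FrechetUrysohnSpace (VHyper X) ∧
         ∃ N : Set (Set (VHyper X)), PointCountableFam N ∧ IsKNetwork N,
       ∃ W : VHyper X → Set (Set (VHyper X)), IsWeakBase W ∧ PointCountableFam (⋃ K, W K),
       ∃ W : VHyper X → Set (Set (VHyper X)), IsWeakBase W ∧ CompactCountableFam (⋃ K, W K),
       ∃ B : Set (Set (VHyper X)), IsBaseFam B ∧ PointCountableFam B] := by
  tfae_have 1 → 6 := one_six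
  tfae_have 6 → 3 := by
    rintro ⟨B, hB, hN⟩
    haveI := firstCountable_of_base hB hN
    exact ⟨inferInstance, B, hN, knet_of_base hB⟩
  tfae_have 3 → 2 := by
    rintro ⟨hF, hk⟩
    exact ⟨inducing_val2.frechetUrysohnSpace, knet_of_inducing inducing_val2 hk⟩
  tfae_have 2 → 1 := two_one
  tfae_have 6 → 5 := by
    rintro ⟨B, hB, hN⟩
    refine ⟨_, weakBase_of_base hB, ?_⟩
    intro C hC
    refine (compactCountable_of_base hB hN C hC).mono ?_
    rintro P ⟨hP, hCP⟩
    obtain ⟨K, hK⟩ := mem_iUnion.1 hP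
    exact ⟨hK.1, hCP⟩
  tfae_have 5 → 4 := by
    rintro ⟨W, hW, hN⟩
    refine ⟨W, hW, fun K => (hN {K} isCompact_singleton).mono ?_⟩
    rintro P ⟨hP, hKP⟩
    exact ⟨hP, K, rfl, hKP⟩
  tfae_have 4 → 1 := four_one
  tfae_finish
end

section
/- For a regular T2 space X the following are equivalent: (1) X has a σ-locally countable base; (2) 𝒦(X) has a σ-locally countable weak base; (3) 𝒦(X) has a σ-locally countable base. -/
open TopologicalSpace Set

open Filter Topology

namespace S9

theorem ext' {X : Type*} [TopologicalSpace X] {A B : VHyper X} (h : A.carrier = B.carrier) :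
    A = B := by
  cases A; cases B; cases h; rfl

theorem isOpen_vbox {X : Type*} [TopologicalSpace X] (Ps : Finset (Set X))
    (h : ∀ U ∈ Ps, IsOpen U) : IsOpen (VHyper.vbox Ps) :=
  TopologicalSpace.isOpen_generateFrom_of_mem ⟨Ps, h, rfl⟩

theorem vbox_singleton {X : Type*} [TopologicalSpace X] (U : Set X) :
    VHyper.vbox {U} = {A : VHyper X | A.carrier ⊆ U} := by
  ext A
  simp only [VHyper.vbox, mem_ofPred_eq, Finset.coe_singleton, sUnion_singleton,
    Finset.mem_singleton, forall_eq, and_iff_left_iff_imp]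
  intro h
  obtain ⟨a, ha⟩ := A.nonempty'
  exact ⟨a, ha, h ha⟩

theorem isOpen_sub {X : Type*} [TopologicalSpace X] {U : Set X} (hU : IsOpen U) :
    IsOpen {A : VHyper X | A.carrier ⊆ U} := by
  rw [← vbox_singleton]
  exact isOpen_vbox _ (by simpa using hU)

theorem isOpen_meet {X : Type*} [TopologicalSpace X] {U : Set X} (hU : IsOpen U) :
    IsOpen {A : VHyper X | (A.carrier ∩ U).Nonempty} := by
  classical
  have : {A : VHyper X | (A.carrier ∩ U).Nonempty} = VHyper.vbox {U, univ} := by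
    ext A
    have := A.nonempty'
    simp [VHyper.vbox, this]
  rw [this]
  exact isOpen_vbox _ (by simpa using hU)

instance t2 {X : Type*} [TopologicalSpace X] [T2Space X] : T2Space (VHyper X) := by
  have key : ∀ A B : VHyper X, ¬ A.carrier ⊆ B.carrier → ∃ u v : Set (VHyper X),
      IsOpen u ∧ IsOpen v ∧ A ∈ u ∧ B ∈ v ∧ Disjoint u v := by
    intro A B h
    obtain ⟨a, haA, haB⟩ := not_subset.1 h
    obtain ⟨V, U, hV, hU, hBV, haU, hd⟩ := B.isCompact'.separation_of_notMem haB
    refine ⟨_, _, isOpen_meet hU, isOpen_sub hV, ⟨a, haA, haU⟩, hBV, ?_⟩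
    rw [Set.disjoint_left]
    rintro K ⟨z, hzK, hzU⟩ hKV
    exact Set.disjoint_left.1 hd (hKV hzK) hzU
  refine ⟨fun A B hne => ?_⟩
  by_cases h : A.carrier ⊆ B.carrier
  · have h2 : ¬ B.carrier ⊆ A.carrier := fun h' => hne (ext' (h.antisymm h'))
    obtain ⟨u, v, hu, hv, h1, h2, h3⟩ := key B A h2
    exact ⟨v, u, hv, hu, h2, h1, h3.symm⟩
  · exact key A B h

/-- singleton -/
def sing {X : Type*} [TopologicalSpace X] (x : X) : VHyper X :=
  ⟨{x}, isCompact_singleton, singleton_nonempty x⟩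

theorem continuous_sing {X : Type*} [TopologicalSpace X] : Continuous (sing : X → VHyper X) := by
  refine continuous_generateFrom_iff.2 ?_
  rintro _ ⟨Ps, hPs, rfl⟩
  have : sing ⁻¹' (VHyper.vbox Ps) = (⋃₀ (Ps : Set (Set X))) ∩ ⋂ P ∈ Ps, P := by
    ext x
    simp [VHyper.vbox, sing]
  rw [this]
  exact (isOpen_sUnion hPs).inter (isOpen_biInter_finset hPs)

theorem seq_nhd {Y : Type*} [TopologicalSpace Y] [T2Space Y] {W : Y → Set (Set Y)}
    (hW : IsWeakBase W) {y : Y} {u : ℕ → Y} (hu : Tendsto u atTop (𝓝 y)) {P : Set Y}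
    (hP : P ∈ W y) : ∀ᶠ n in atTop, u n ∈ P := by
  by_contra hcon
  rw [not_eventually] at hcon
  obtain ⟨φ, hφ, hφ2⟩ := extraction_of_frequently_atTop hcon
  have hv : Tendsto (u ∘ φ) atTop (𝓝 y) := hu.comp hφ.tendsto_atTop
  have hcl : IsClosed (insert y (range (u ∘ φ))) := hv.isCompact_insert_range.isClosed
  have hG : IsOpen (range (u ∘ φ))ᶜ := by
    apply hW.2.2.2
    intro z hz
    by_cases hzy : z = y
    · subst hzy
      refine ⟨P, hP, ?_⟩
      rintro p hp ⟨n, rfl⟩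
      exact hφ2 n hp
    · obtain ⟨Q, hQ, hQs⟩ := hW.2.2.1 z _ hcl.isOpen_compl (by
        rintro (h | h)
        · exact hzy h
        · exact hz h)
      exact ⟨Q, hQ, hQs.trans (compl_subset_compl.2 (subset_insert _ _))⟩
  have hy : y ∈ (range (u ∘ φ))ᶜ := by
    rintro ⟨n, hn⟩
    exact hφ2 n (by
      have := hW.1 y P hP
      rw [← hn] at this
      exact this)
  obtain ⟨n, hn⟩ := (hv.eventually (hG.mem_nhds hy)).exists
  exact hn ⟨n, rfl⟩

theorem anti {Y : Type*} [TopologicalSpace Y] {W : Y → Set (Set Y)}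
    (hW : IsWeakBase W) (y : Y) (hc : (W y).Countable) :
    ∃ V : ℕ → Set Y, Antitone V ∧ (∀ n, V n ∈ W y) ∧
      ∀ U : Set Y, IsOpen U → y ∈ U → ∃ n, V n ⊆ U := by
  obtain ⟨P0, hP0, -⟩ := hW.2.2.1 y univ isOpen_univ (mem_univ y)
  obtain ⟨e, he⟩ := hc.exists_eq_range ⟨P0, hP0⟩
  have heW : ∀ n, e n ∈ W y := fun n => he ▸ mem_range_self n
  have hstep : ∀ (U : W y) (n : ℕ), ∃ Z : W y, (Z : Set Y) ⊆ U ∩ e n := by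
    intro U n
    obtain ⟨Z, hZ, h⟩ := hW.2.1 y U U.2 (e n) (heW n)
    exact ⟨⟨Z, hZ⟩, h⟩
  choose f hf using hstep
  let V : ℕ → W y := fun n => Nat.rec ⟨P0, hP0⟩ (fun k U => f U k) n
  have hV : ∀ n, (V (n+1)).1 ⊆ (V n).1 ∩ e n := fun n => hf (V n) n
  refine ⟨fun n => (V n).1, antitone_nat_of_succ_le fun n => (hV n).trans inter_subset_left,
    fun n => (V n).2, ?_⟩
  intro U hU hy
  obtain ⟨P, hP, hPU⟩ := hW.2.2.1 y U hU hy
  rw [he] at hP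
  obtain ⟨n, rfl⟩ := hP
  exact ⟨n+1, ((hV n).trans inter_subset_right).trans hPU⟩

theorem seqSp {Y : Type*} [TopologicalSpace Y] {W : Y → Set (Set Y)}
    (hW : IsWeakBase W) (hc : ∀ y, (W y).Countable) {A : Set Y} (hA : IsSeqClosed A) :
    IsClosed A := by
  rw [← isOpen_compl_iff]
  apply hW.2.2.2
  intro y hy
  obtain ⟨V, hVa, hVW, hVn⟩ := anti hW y (hc y)
  by_contra hcon
  push Not at hcon
  have : ∀ n, ∃ a ∈ V n, a ∈ A := by
    intro n
    obtain ⟨a, ha, ha'⟩ := not_subset.1 (hcon _ (hVW n))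
    exact ⟨a, ha, not_not.1 ha'⟩
  choose a haV haA using this
  refine hy (hA haA ?_)
  refine tendsto_nhds.2 fun U hU hyU => ?_
  obtain ⟨n, hn⟩ := hVn U hU hyU
  filter_upwards [eventually_ge_atTop n] with k hk
  exact hn (hVa hk (haV k))

theorem wb_countable {Y : Type*} [TopologicalSpace Y] {W : Y → Set (Set Y)} (hW : IsWeakBase W)
    {B : ℕ → Set (Set Y)} (hB : (⋃ K, W K) = ⋃ n, B n) (hl : ∀ n, LocallyCountableFam (B n))
    (y : Y) : (W y).Countable := by
  have : W y ⊆ ⋃ n, {P ∈ B n | y ∈ P} := by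
    intro P hP
    have h : P ∈ ⋃ n, B n := hB ▸ mem_iUnion.2 ⟨y, hP⟩
    obtain ⟨n, hn⟩ := mem_iUnion.1 h
    exact mem_iUnion.2 ⟨n, hn, hW.1 y P hP⟩
  refine Countable.mono this (countable_iUnion fun n => ?_)
  obtain ⟨O, hO, hOc⟩ := hl n y
  refine hOc.mono ?_
  intro P hP
  exact ⟨hP.1, y, mem_of_mem_nhds hO, hP.2⟩

theorem diag {X : Type*} [TopologicalSpace X] [T2Space X] {W : VHyper X → Set (Set (VHyper X))}
    (hW : IsWeakBase W) (hc : ∀ K, (W K).Countable) {x : X} {s : ℕ → X}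
    (hs : Tendsto s atTop (𝓝 x)) {u : ℕ → ℕ → X} (hu : ∀ n, Tendsto (u n) atTop (𝓝 (s n))) :
    ∃ m : ℕ → ℕ, Tendsto (fun k => u k (m k)) atTop (𝓝 x) := by
  have hK : ∀ j, IsCompact (insert x (range fun n => s (n + j))) := fun j =>
    Tendsto.isCompact_insert_range ((tendsto_add_atTop_iff_nat j).2 hs)
  let K : ℕ → VHyper X := fun j => ⟨_, hK j, insert_nonempty _ _⟩
  let L : ℕ → X → VHyper X := fun j y => ⟨_, (hK j).insert y, insert_nonempty _ _⟩
  have hL : ∀ k j, j ≤ k → Tendsto (fun m => L j (u k m)) atTop (𝓝 (K j)) := by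
    intro k j hjk
    refine TopologicalSpace.tendsto_nhds_generateFrom_iff.2 ?_
    rintro _ ⟨Ps, hPs, rfl⟩ hKP
    have hmem : s k ∈ (K j).carrier := Or.inr ⟨k - j, by simp [hjk]⟩
    have := (hu k).eventually ((isOpen_sUnion hPs).mem_nhds (hKP.1 hmem))
    filter_upwards [this] with m hm
    refine ⟨insert_subset hm hKP.1, fun P hP => ?_⟩
    exact (hKP.2 P hP).mono (inter_subset_inter_left _ (subset_insert _ _))
  choose V hVa hVW hVn using fun j => anti hW (K j) (hc (K j))
  have : ∀ k, ∃ m, ∀ j ∈ Finset.range (k+1), L j (u k m) ∈ V j k := by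
    intro k
    refine Eventually.exists (f := atTop) ?_
    rw [Finset.eventually_all]
    intro j hj
    exact seq_nhd hW (hL k j (by simpa [Nat.lt_succ_iff] using hj)) (hVW j k)
  choose m hm using this
  refine ⟨m, tendsto_nhds.2 fun U hU hxU => ?_⟩
  obtain ⟨j, hj⟩ := eventually_atTop.1 (hs.eventually (hU.mem_nhds hxU))
  have hKU : (K j).carrier ⊆ U := by
    refine insert_subset hxU ?_
    rintro _ ⟨n, rfl⟩
    exact hj _ (Nat.le_add_left _ _)
  obtain ⟨k0, hk0⟩ := hVn j _ (isOpen_sub hU) hKU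
  filter_upwards [eventually_ge_atTop (max j k0)] with k hk
  have h1 := hm k j (by simp; omega)
  have h2 := hk0 (hVa j (le_of_max_le_right hk) h1)
  exact h2 (Or.inl rfl)

theorem wb_sing {X : Type*} [TopologicalSpace X] [T2Space X]
    {W : VHyper X → Set (Set (VHyper X))} (hW : IsWeakBase W) :
    IsWeakBase (fun x : X => (fun P => sing ⁻¹' P) '' W (sing x)) := by
  refine ⟨?_, ?_, ?_, ?_⟩
  · rintro x _ ⟨P, hP, rfl⟩
    exact hW.1 _ P hP
  · rintro x _ ⟨P, hP, rfl⟩ _ ⟨Q, hQ, rfl⟩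
    obtain ⟨Z, hZ, h⟩ := hW.2.1 _ P hP Q hQ
    exact ⟨_, ⟨Z, hZ, rfl⟩, fun z hz => h hz⟩
  · intro x U hU hx
    obtain ⟨P, hP, h⟩ := hW.2.2.1 (sing x) _ (isOpen_sub hU) (by simpa [sing] using hx)
    exact ⟨_, ⟨P, hP, rfl⟩, fun z hz => h hz rfl⟩
  · intro G hG
    have : IsOpen {A : VHyper X | ∀ x, A = sing x → x ∈ G} := by
      apply hW.2.2.2
      intro A hA
      by_cases hs : ∃ x, A = sing x
      · obtain ⟨x, rfl⟩ := hs
        obtain ⟨_, ⟨P, hP, rfl⟩, h⟩ := hG x (hA x rfl)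
        refine ⟨P, hP, ?_⟩
        rintro B hB z rfl
        exact h hB
      · obtain ⟨a, ha⟩ := A.nonempty'
        have : ∃ b ∈ A.carrier, b ≠ a := by
          by_contra hcon
          push Not at hcon
          refine hs ⟨a, ext' ?_⟩
          ext z
          exact ⟨fun h => hcon z h, fun h => by rw [show z = a from h]; exact ha⟩
        obtain ⟨b, hb, hba⟩ := this
        obtain ⟨U, V, hU, hV, hbU, haV, hd⟩ := t2_separation hba
        obtain ⟨P, hP, h⟩ := hW.2.2.1 A _ ((isOpen_meet hU).inter (isOpen_meet hV))
          ⟨⟨b, hb, hbU⟩, ⟨a, ha, haV⟩⟩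
        refine ⟨P, hP, ?_⟩
        rintro B hB z rfl
        obtain ⟨⟨p, hp, hpU⟩, ⟨q, hq, hqV⟩⟩ := h hB
        rw [show p = z from hp] at hpU
        rw [show q = z from hq] at hqV
        exact (Set.disjoint_left.1 hd hpU hqV).elim
    convert this.preimage continuous_sing using 1
    ext x
    constructor
    · intro hx z hz
      have : ({x} : Set X) = {z} := congrArg VHyper.carrier hz
      rwa [← singleton_eq_singleton_iff.1 this]
    · intro h
      exact h x rfl

theorem two_one {X : Type*} [TopologicalSpace X] [T2Space X]
    {W : VHyper X → Set (Set (VHyper X))} (hW : IsWeakBase W)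
    {B : ℕ → Set (Set (VHyper X))} (hB : (⋃ K, W K) = ⋃ n, B n)
    (hl : ∀ n, LocallyCountableFam (B n)) :
    ∃ B : ℕ → Set (Set X), (∀ n, LocallyCountableFam (B n)) ∧ IsBaseFam (⋃ n, B n) := by
  have hc := wb_countable hW hB hl
  have hQ := wb_sing hW
  have hQc : ∀ x : X, ((fun P => sing ⁻¹' P) '' W (sing x)).Countable :=
    fun x => (hc _).image _
  refine ⟨fun n => (fun P => interior (sing ⁻¹' P)) '' B n, ?_, ?_, ?_⟩
  · intro n x
    obtain ⟨O, hO, hOc⟩ := hl n (sing x)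
    refine ⟨sing ⁻¹' O, continuous_sing.continuousAt hO,
      (hOc.image (fun P => interior (sing ⁻¹' P))).mono ?_⟩
    rintro _ ⟨⟨P, hP, rfl⟩, z, hzO, hzP⟩
    have hz2 : z ∈ sing ⁻¹' P := interior_subset hzP
    exact ⟨P, ⟨hP, sing z, hzO, hz2⟩, rfl⟩
  · intro P hP
    obtain ⟨n, Q, -, rfl⟩ := mem_iUnion.1 hP
    exact isOpen_interior
  · intro U hU x hx
    obtain ⟨_, ⟨P, hP, rfl⟩, hPU⟩ := hQ.2.2.1 x U hU hx
    have hPB : P ∈ ⋃ n, B n := hB ▸ mem_iUnion.2 ⟨_, hP⟩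
    obtain ⟨n, hn⟩ := mem_iUnion.1 hPB
    refine ⟨_, mem_iUnion.2 ⟨n, P, hn, rfl⟩, ?_, interior_subset.trans hPU⟩
    by_contra hx'
    have hcl : x ∈ closure (sing ⁻¹' P)ᶜ := by rwa [closure_compl]
    have hsc : IsSeqClosed (seqClosure (sing ⁻¹' P)ᶜ) := by
      intro s y hs hsy
      choose u hu hus using hs
      obtain ⟨m, hm⟩ := diag hW hc hsy hus
      exact ⟨_, fun k => hu k (m k), hm⟩
    have hcl2 := seqSp hQ hQc hsc
    obtain ⟨u, hu, hux⟩ := closure_minimal subset_seqClosure hcl2 hcl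
    obtain ⟨k, hk⟩ := (seq_nhd hQ hux ⟨P, hP, rfl⟩).exists
    exact hu k hk

theorem three_two {Y : Type*} [TopologicalSpace Y] {B : ℕ → Set (Set Y)}
    (hl : ∀ n, LocallyCountableFam (B n)) (hB : IsBaseFam (⋃ n, B n)) :
    ∃ W : Y → Set (Set Y), IsWeakBase W ∧
         ∃ B : ℕ → Set (Set Y), (⋃ K, W K) = (⋃ n, B n) ∧
           ∀ n, LocallyCountableFam (B n) := by
  refine ⟨fun y => {P | P ∈ (⋃ n, B n) ∧ y ∈ P}, ⟨?_, ?_, ?_, ?_⟩,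
    fun n => {P | P ∈ B n ∧ P.Nonempty}, ?_, ?_⟩
  · exact fun y P hP => hP.2
  · intro y U hU V hV
    obtain ⟨P, hP, hy, h⟩ := hB.2 (U ∩ V) ((hB.1 U hU.1).inter (hB.1 V hV.1)) y ⟨hU.2, hV.2⟩
    exact ⟨P, ⟨hP, hy⟩, h⟩
  · intro y U hU hy
    obtain ⟨P, hP, hy, h⟩ := hB.2 U hU y hy
    exact ⟨P, ⟨hP, hy⟩, h⟩
  · intro G hG
    refine isOpen_iff_mem_nhds.2 fun y hy => ?_
    obtain ⟨P, hP, h⟩ := hG y hy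
    exact mem_of_superset ((hB.1 P hP.1).mem_nhds hP.2) h
  · ext P
    simp only [mem_iUnion, mem_ofPred_eq]
    constructor
    · rintro ⟨y, ⟨n, hn⟩, hy⟩
      exact ⟨n, hn, y, hy⟩
    · rintro ⟨n, hn, y, hy⟩
      exact ⟨y, ⟨n, hn⟩, hy⟩
  · intro n y
    obtain ⟨O, hO, hc⟩ := hl n y
    refine ⟨O, hO, hc.mono ?_⟩
    intro P hP
    exact ⟨hP.1.1, hP.2⟩

theorem exists_vbox {X : Type*} [TopologicalSpace X] {U : Set (VHyper X)} (hU : IsOpen U)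
    {K : VHyper X} (hK : K ∈ U) {B : Set (Set X)} (hB : IsBaseFam B) :
    ∃ Ps : Finset (Set X), (Ps : Set (Set X)) ⊆ B ∧ K ∈ VHyper.vbox Ps ∧ VHyper.vbox Ps ⊆ U := by
  classical
  -- it suffices to handle a finite collection of opens refining
  have h1 : ∃ Fs : Finset (Finset (Set X)), (∀ Qs ∈ Fs, (∀ V ∈ Qs, IsOpen V) ∧
      K ∈ VHyper.vbox Qs) ∧ ∀ A, (∀ Qs ∈ Fs, A ∈ VHyper.vbox Qs) → A ∈ U := by
    induction hU with
    | basic s hs =>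
      obtain ⟨Ps, hPs, rfl⟩ := hs
      exact ⟨{Ps}, by simpa using ⟨hPs, hK⟩, by simp⟩
    | univ => exact ⟨∅, by simp, by simp⟩
    | inter s t _ _ ihs iht =>
      obtain ⟨F, hF, hF'⟩ := ihs hK.1
      obtain ⟨G, hG, hG'⟩ := iht hK.2
      refine ⟨F ∪ G, ?_, ?_⟩
      · intro Qs hQ
        rcases Finset.mem_union.1 hQ with h | h
        · exact hF _ h
        · exact hG _ h
      · intro A hA
        exact ⟨hF' A fun Q hQ => hA Q (Finset.mem_union_left _ hQ),
          hG' A fun Q hQ => hA Q (Finset.mem_union_right _ hQ)⟩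
    | sUnion S _ ih =>
      obtain ⟨s, hs, hKs⟩ := hK
      obtain ⟨F, hF, hF'⟩ := ih s hs hKs
      exact ⟨F, hF, fun A hA => ⟨s, hs, hF' A hA⟩⟩
  obtain ⟨Fs, hFs, hFU⟩ := h1
  -- the finite family of all opens
  let T : Finset (Set X) := Fs.biUnion id
  have hTo : ∀ V ∈ T, IsOpen V := by
    intro V hV
    obtain ⟨Q, hQ, hVQ⟩ := Finset.mem_biUnion.1 hV
    exact (hFs Q hQ).1 V hVQ
  have hb : ∀ x, ∃ P ∈ B, x ∈ P ∧ P ⊆ ⋂ V ∈ T.filter (fun V => x ∈ V), V := by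
    intro x
    refine hB.2 _ (isOpen_biInter_finset fun V hV => hTo V (Finset.mem_filter.1 hV).1) x ?_
    simp
  choose b hbB hxb hbs using hb
  have hbs' : ∀ x, ∀ V ∈ T, x ∈ V → b x ⊆ V := by
    intro x V hV hx
    exact (hbs x).trans (biInter_subset_of_mem (Finset.mem_filter.2 ⟨hV, hx⟩))
  obtain ⟨t, htK, htc⟩ := K.isCompact'.elim_nhds_subcover b
    (fun x _ => (hB.1 _ (hbB x)).mem_nhds (hxb x))
  have hp : ∀ V, ∃ x, x ∈ K.carrier ∧ (V ∈ T → x ∈ V) := by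
    intro V
    by_cases hV : V ∈ T
    · obtain ⟨Q, hQ, hVQ⟩ := Finset.mem_biUnion.1 hV
      obtain ⟨x, hx, hxV⟩ := (hFs Q hQ).2.2 V hVQ
      exact ⟨x, hx, fun _ => hxV⟩
    · obtain ⟨x, hx⟩ := K.nonempty'
      exact ⟨x, hx, fun h => (hV h).elim⟩
  choose p hpK hpV using hp
  let t' := t ∪ T.image p
  have ht'K : ∀ x ∈ t', x ∈ K.carrier := by
    intro x hx
    rcases Finset.mem_union.1 hx with h | h
    · exact htK x h
    · obtain ⟨V, -, rfl⟩ := Finset.mem_image.1 h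
      exact hpK V
  refine ⟨t'.image b, ?_, ⟨?_, ?_⟩, ?_⟩
  · intro P hP
    obtain ⟨x, -, rfl⟩ := Finset.mem_image.1 (Finset.mem_coe.1 hP)
    exact hbB x
  · intro z hz
    obtain ⟨x, hx, hzx⟩ := mem_iUnion₂.1 (htc hz)
    exact ⟨b x, Finset.mem_coe.2 (Finset.mem_image_of_mem _ (Finset.mem_union_left _ hx)), hzx⟩
  · intro P hP
    obtain ⟨x, hx, rfl⟩ := Finset.mem_image.1 hP
    exact ⟨x, ht'K x hx, hxb x⟩
  · intro A hA
    refine hFU A fun Q hQ => ⟨?_, ?_⟩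
    · intro z hz
      obtain ⟨P, hP, hzP⟩ := hA.1 hz
      obtain ⟨x, hx, rfl⟩ := Finset.mem_image.1 (Finset.mem_coe.1 hP)
      obtain ⟨V, hV, hxV⟩ := (hFs Q hQ).2.1 (ht'K x hx)
      exact ⟨V, hV, hbs' x V (Finset.mem_biUnion.2 ⟨Q, hQ, hV⟩) hxV hzP⟩
    · intro V hV
      have hVT : V ∈ T := Finset.mem_biUnion.2 ⟨Q, hQ, hV⟩
      obtain ⟨z, hzA, hzb⟩ := hA.2 (b (p V)) (Finset.mem_image_of_mem _
        (Finset.mem_union_right _ (Finset.mem_image_of_mem _ hVT)))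
      exact ⟨z, hzA, hbs' _ V hVT (hpV V hVT) hzb⟩

theorem one_three {X : Type*} [TopologicalSpace X] {B : ℕ → Set (Set X)}
    (hl : ∀ n, LocallyCountableFam (B n)) (hB : IsBaseFam (⋃ n, B n)) :
    ∃ B : ℕ → Set (Set (VHyper X)), (∀ n, LocallyCountableFam (B n)) ∧
         IsBaseFam (⋃ n, B n) := by
  classical
  refine ⟨fun n => {S | ∃ Ps : Finset (Set X), (∀ P ∈ Ps, ∃ i ≤ n, P ∈ B i) ∧
    S = VHyper.vbox Ps}, ?_, ?_, ?_⟩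
  · intro n K
    have h1 : ∀ x : X, ∃ O : Set X, IsOpen O ∧ x ∈ O ∧
        {P | (∃ i ≤ n, P ∈ B i) ∧ (O ∩ P).Nonempty}.Countable := by
      intro x
      choose O hO hOc using fun i => hl i x
      refine ⟨interior (⋂ i ∈ Finset.range (n+1), O i), isOpen_interior,
        mem_interior_iff_mem_nhds.2 ((Filter.biInter_finset_mem _).2 fun i _ => hO i), ?_⟩
      refine (countable_iUnion hOc).mono ?_
      rintro P ⟨⟨i, hi, hP⟩, z, hz, hzP⟩
      have := mem_iInter₂.1 (interior_subset hz) i (by simp; omega)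
      exact mem_iUnion.2 ⟨i, hP, z, this, hzP⟩
    choose O hOo hxO hOc using h1
    obtain ⟨t, -, htc⟩ := K.isCompact'.elim_nhds_subcover O
      (fun x _ => (hOo x).mem_nhds (hxO x))
    have hcount : {P | (∃ i ≤ n, P ∈ B i) ∧ ((⋃ x ∈ t, O x) ∩ P).Nonempty}.Countable := by
      refine (t.countable_toSet.biUnion fun x _ => hOc x).mono ?_
      rintro P ⟨hP, z, hz, hzP⟩
      obtain ⟨x, hxt, hzx⟩ := mem_iUnion₂.1 hz
      exact mem_iUnion₂.2 ⟨x, hxt, hP, z, hzx, hzP⟩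
    refine ⟨_, (S9.isOpen_sub (isOpen_biUnion fun x (_ : x ∈ t) => hOo x)).mem_nhds htc, ?_⟩
    have hfin : {Ps : Finset (Set X) | (Ps : Set (Set X)) ⊆
        {P | (∃ i ≤ n, P ∈ B i) ∧ ((⋃ x ∈ t, O x) ∩ P).Nonempty}}.Countable :=
      ((Set.countable_ofPred_finite_subset hcount).preimage
        Finset.coe_injective).mono (by
          intro Ps h
          exact ⟨Ps.finite_toSet, h⟩)
    refine (hfin.image VHyper.vbox).mono ?_
    rintro _ ⟨⟨Ps, hPs, rfl⟩, A, hAO, hA⟩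
    refine ⟨Ps, fun P hP => ⟨hPs P hP, ?_⟩, rfl⟩
    obtain ⟨z, hzA, hzP⟩ := hA.2 P hP
    exact ⟨z, hAO hzA, hzP⟩
  · intro S hS
    obtain ⟨n, Ps, hPs, rfl⟩ := mem_iUnion.1 hS
    refine isOpen_vbox _ fun P hP => ?_
    obtain ⟨i, -, hi⟩ := hPs P hP
    exact hB.1 P (mem_iUnion.2 ⟨i, hi⟩)
  · intro U hU K hK
    obtain ⟨Ps, hPs, hKP, hPU⟩ := exists_vbox hU hK hB
    refine ⟨_, mem_iUnion.2 ?_, hKP, hPU⟩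
    have : ∀ P, ∃ i, P ∈ Ps → P ∈ B i := by
      intro P
      by_cases h : P ∈ Ps
      · obtain ⟨i, hi⟩ := mem_iUnion.1 (hPs h)
        exact ⟨i, fun _ => hi⟩
      · exact ⟨0, fun h' => (h h').elim⟩
    choose i hi using this
    exact ⟨Ps.sup i, Ps, fun P hP => ⟨i P, Finset.le_sup hP, hi P hP⟩, rfl⟩

end S9

theorem statement9 {X : Type*} [TopologicalSpace X] [T2Space X] [RegularSpace X] :
    List.TFAE
      [∃ B : ℕ → Set (Set X), (∀ n, LocallyCountableFam (B n)) ∧ IsBaseFam (⋃ n, B n),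
       ∃ W : VHyper X → Set (Set (VHyper X)), IsWeakBase W ∧
         ∃ B : ℕ → Set (Set (VHyper X)), (⋃ K, W K) = (⋃ n, B n) ∧
           ∀ n, LocallyCountableFam (B n),
       ∃ B : ℕ → Set (Set (VHyper X)), (∀ n, LocallyCountableFam (B n)) ∧
         IsBaseFam (⋃ n, B n)] := by
  tfae_have 1 → 3 := by
    rintro ⟨B, hl, hB⟩
    exact S9.one_three hl hB
  tfae_have 3 → 2 := by
    rintro ⟨B, hl, hB⟩
    exact S9.three_two hl hB
  tfae_have 2 → 1 := by
    rintro ⟨W, hW, B, hB, hl⟩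
    exact S9.two_one hW hB hl
  tfae_finish
end

section
/- Let X be a regular T2 space with topology τ_X and let g : ℕ × X → τ_X satisfy: x ∈ g(n,x) for all n and x, ⋂_{n∈ℕ} g(n,x) = {x} for every x ∈ X, g(n+1,x) ⊆ g(n,x) for all n and x, and whenever y ∈ g(n,x) then g(n,y) ⊆ g(n,x). Then for every nonempty compact subset K ⊆ X one has ⋂_{n∈ℕ} (⋃_{x∈K} g(n,x)) = K. -/
open TopologicalSpace Set

/-- For an α-space-type `g`-function which is decreasing in `n`, every nonempty compact
`K` satisfies `⋂ n, ⋃_{x ∈ K} g n x = K`. -/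
theorem statement12 {X : Type*} [TopologicalSpace X] [T2Space X] [RegularSpace X]
    (g : ℕ → X → Set X)
    (hopen : ∀ n x, IsOpen (g n x)) (hmem : ∀ n x, x ∈ g n x)
    (hsep : ∀ x : X, ⋂ n, g n x = {x})
    (hdec : ∀ n x, g (n + 1) x ⊆ g n x)
    (hmono : ∀ n x y, y ∈ g n x → g n y ⊆ g n x) :
    ∀ K : Set X, IsCompact K → K.Nonempty → ⋂ n, ⋃ x ∈ K, g n x = K := by
  intro K hK _
  have hanti : ∀ x, Antitone (fun n => g n x) := fun x => antitone_nat_of_succ_le (fun n => hdec n x)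
  apply Set.Subset.antisymm
  · intro y hy
    by_contra hyK
    have h1 : ∀ x : X, ∃ n, x ∈ K → y ∉ g n x := by
      intro x
      by_contra! hc
      have hy' : y ∈ ⋂ n, g n x := Set.mem_iInter.2 (fun n => (hc n).2)
      rw [hsep x] at hy'
      have hyx : y = x := hy'
      exact hyK (hyx ▸ (hc 0).1)
    choose N hN using h1
    obtain ⟨t, htK, ht⟩ := hK.elim_nhds_subcover (fun x => g (N x) x)
      (fun x _ => (hopen _ _).mem_nhds (hmem _ _))
    have hy2 := Set.mem_iInter.1 hy (t.sup N)
    simp only [Set.mem_iUnion] at hy2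
    obtain ⟨z, hz, hyz⟩ := hy2
    have hz2 := ht hz
    simp only [Set.mem_iUnion] at hz2
    obtain ⟨x, hx, hzx⟩ := hz2
    exact hN x (htK x hx) (hmono _ _ _ hzx (hanti z (Finset.le_sup hx) hyz))
  · intro y hy
    exact Set.mem_iInter.2 (fun n => Set.mem_biUnion hy (hmem n y))
end

section
/- A regular T2 space X has a base of countable order if and only if ℱ(X), the space of nonempty finite subsets of X with the Vietoris topology, has a base of countable order. -/
open TopologicalSpace Set

/-- A base of countable order: a sequence of bases such that every decreasing choice of
members around a point is a local base at that point. -/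
def HasBCO (Y : Type*) [TopologicalSpace Y] : Prop :=
  ∃ B : ℕ → Set (Set Y), (∀ n, IsBaseFam (B n)) ∧
    ∀ (b : ℕ → Set Y) (y : Y), (∀ n, b n ∈ B n) → (∀ n, y ∈ b n) →
      (∀ n, b (n + 1) ⊆ b n) →
      ∀ U : Set Y, IsOpen U → y ∈ U → ∃ n, b n ⊆ U

theorem bco_of_sieve {Y : Type*} [TopologicalSpace Y] {T : Type*} (r : T) (S : T → Set T)
    (G : T → Set Y) (hr : G r = univ) (ho : ∀ t, IsOpen (G t))
    (hc : ∀ t, ∀ y ∈ G t, ∃ s ∈ S t, y ∈ G s)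
    (hb : ∀ a : ℕ → T, a 0 = r → (∀ n, a (n+1) ∈ S (a n)) → ∀ y, (∀ n, y ∈ G (a n)) →
      ∀ U, IsOpen U → y ∈ U → ∃ n, G (a n) ⊆ U) : HasBCO Y := by
  classical
  obtain ⟨_, hwf⟩ := exists_wellOrder T
  have hn : ∀ t y, ∃ s, y ∈ G t → s ∈ S t ∧ y ∈ G s ∧ ∀ s' ∈ S t, y ∈ G s' → s ≤ s' := by
    intro t y
    by_cases h : y ∈ G t
    · obtain ⟨s, ⟨hs1, hs2⟩, hs⟩ :=
        hwf.wf.has_min {s | s ∈ S t ∧ y ∈ G s} (by obtain ⟨s, h1, h2⟩ := hc t y h; exact ⟨s, h1, h2⟩)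
      exact ⟨s, fun _ => ⟨hs1, hs2, fun s' h1 h2 => not_lt.1 (hs s' ⟨h1, h2⟩)⟩⟩
    · exact ⟨t, fun h' => absurd h' h⟩
  choose nxt hnxt using hn
  let α : Y → ℕ → T := fun y n => Nat.rec r (fun _ t => nxt t y) n
  have hα0 : ∀ y, α y 0 = r := fun y => rfl
  have hαs : ∀ y n, α y (n+1) = nxt (α y n) y := fun y n => rfl
  have hαG : ∀ y n, y ∈ G (α y n) := by
    intro y n
    induction n with
    | zero => rw [hα0, hr]; trivial
    | succ n ih => rw [hαs]; exact (hnxt _ _ ih).2.1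
  have hαS : ∀ y n, α y (n+1) ∈ S (α y n) := fun y n => (hnxt _ _ (hαG y n)).1
  have hαm : ∀ y n, ∀ s ∈ S (α y n), y ∈ G s → α y (n+1) ≤ s :=
    fun y n => (hnxt _ _ (hαG y n)).2.2
  clear_value α
  refine ⟨fun n => {b | IsOpen b ∧ ∃ y ∈ b, ∀ i ≤ n, b ⊆ G (α y i)}, ?_, ?_⟩
  · intro n
    refine ⟨fun P h => h.1, fun U hU y hy => ?_⟩
    refine ⟨U ∩ ⋂ i ∈ Finset.range (n+1), G (α y i), ⟨?_, y, ?_, ?_⟩, ?_, inter_subset_left⟩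
    · exact hU.inter (isOpen_biInter_finset fun i _ => ho _)
    · exact ⟨hy, by simp [hαG]⟩
    · intro i hi z hz
      have := hz.2
      simp only [mem_iInter] at this
      exact this i (by simp; omega)
    · exact ⟨hy, by simp [hαG]⟩
  · intro b x hbB hx hdec U hU hxU
    have hanti : Antitone b := antitone_nat_of_succ_le hdec
    choose hbo y hy hyG using hbB
    have key : ∀ k, ∃ N, k ≤ N ∧ ∀ n, N ≤ n → ∀ j ≤ k, α (y n) j = α (y N) j := by
      intro k
      induction k with
      | zero =>
        refine ⟨0, le_rfl, fun n _ j hj => ?_⟩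
        obtain rfl : j = 0 := by omega
        rw [hα0, hα0]
      | succ k ih =>
        obtain ⟨N, hkN, hN⟩ := ih
        obtain ⟨_, ⟨m, hm, rfl⟩, hmin⟩ := hwf.wf.has_min
          ((fun n => α (y n) (k+1)) '' {n | N + 1 ≤ n}) ⟨_, N+1, le_refl (N+1), rfl⟩
        simp only [mem_setOf_eq] at hm
        refine ⟨m, by omega, fun n hn j hj => ?_⟩
        rcases Nat.lt_or_ge k j with h | h
        · obtain rfl : j = k + 1 := by omega
          refine le_antisymm ?_ (not_lt.1 (hmin _ ⟨n, ?_, rfl⟩))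
          · refine hαm _ _ _ ?_ ?_
            · have := hαS (y m) k
              rwa [hN m (by omega) k le_rfl, ← hN n (by omega) k le_rfl] at this
            · exact hyG m (k+1) (by omega) (hanti hn (hy n))
          · simp only [mem_setOf_eq]; omega
        · rw [hN n (by omega) j h, hN m (by omega) j h]
    choose N hkN hN using key
    obtain ⟨n, hn⟩ := hb (fun k => α (y (N k)) k) (hα0 _) (fun k => by
      have h := hαS (y (max (N k) (N (k+1)))) k
      rw [hN k _ (le_max_left _ _) k le_rfl, hN (k+1) _ (le_max_right _ _) (k+1) le_rfl] at h
      exact h) x (fun k => hyG _ k (hkN k) (hx _)) U hU hxU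
    exact ⟨N n, (hyG _ n (hkN n)).trans hn⟩

theorem konig_aux {T : Type*} (F : ℕ → Finset T) (R : T → T → Prop) (bad : T → Prop)
    (hne : ∀ n, ∃ t ∈ F n, bad t)
    (hpar : ∀ n, ∀ s ∈ F (n+1), bad s → ∃ t ∈ F n, bad t ∧ R t s) :
    ∃ a : ℕ → T, (∀ n, a n ∈ F n ∧ bad (a n)) ∧ ∀ n, R (a n) (a (n+1)) := by
  classical
  let D : ℕ → ℕ → T → Prop := fun m => Nat.rec (fun n t => t ∈ F n ∧ bad t)
    (fun _ ih n t => t ∈ F n ∧ bad t ∧ ∃ s, R t s ∧ ih (n+1) s) m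
  have hD0 : ∀ n t, D 0 n t ↔ t ∈ F n ∧ bad t := fun n t => Iff.rfl
  have hDs : ∀ m n t, D (m+1) n t ↔ t ∈ F n ∧ bad t ∧ ∃ s, R t s ∧ D m (n+1) s :=
    fun m n t => Iff.rfl
  clear_value D
  have hDF : ∀ m n t, D m n t → t ∈ F n ∧ bad t := by
    intro m n t h
    cases m with
    | zero => exact (hD0 _ _).1 h
    | succ m => exact ⟨((hDs _ _ _).1 h).1, ((hDs _ _ _).1 h).2.1⟩
  have hDanti : ∀ m n t, D (m+1) n t → D m n t := by
    intro m
    induction m with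
    | zero => intro n t h; exact (hD0 _ _).2 (hDF _ _ _ h)
    | succ m ih =>
      intro n t h
      obtain ⟨h1, h2, s, h3, h4⟩ := (hDs _ _ _).1 h
      exact (hDs _ _ _).2 ⟨h1, h2, s, h3, ih _ _ h4⟩
  have hDle : ∀ n t m m', m ≤ m' → D m' n t → D m n t := by
    intro n t m m' h
    induction h with
    | refl => exact id
    | step _ ih => exact fun h => ih (hDanti _ _ _ h)
  have pig : ∀ n (P : T → Prop), (∀ m, ∃ t, P t ∧ D m n t) → ∃ t, P t ∧ ∀ m, D m n t := by
    intro n P h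
    by_contra! hcon
    have : ∀ t, ∃ m, P t → ¬ D m n t := by
      intro t
      by_cases hp : P t
      · obtain ⟨m, hm⟩ := hcon t hp
        exact ⟨m, fun _ => hm⟩
      · exact ⟨0, fun h => absurd h hp⟩
    choose f hf using this
    obtain ⟨t, ht, hd⟩ := h ((F n).sup f)
    exact hf t ht (hDle _ _ _ _ (Finset.le_sup (hDF _ _ _ hd).1) hd)
  have hex : ∀ m n, ∃ t, D m n t := by
    have : ∀ m n s, s ∈ F (n+m) → bad s → ∃ t, D m n t := by
      have aux : ∀ k n m s, D k (n+m) s → ∃ t, D (k+m) n t := by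
        intro k n m
        induction m generalizing k with
        | zero => intro s h; exact ⟨s, h⟩
        | succ m ih =>
          intro s h
          obtain ⟨h1, h2⟩ := hDF _ _ _ h
          obtain ⟨t, h3, h4, h5⟩ := hpar (n+m) s h1 h2
          have := ih (k+1) t ((hDs _ _ _).2 ⟨h3, h4, s, h5, h⟩)
          rwa [show k + 1 + m = k + (m+1) by omega] at this
      intro m n s h1 h2
      have := aux 0 n m s ((hD0 _ _).2 ⟨h1, h2⟩)
      rwa [Nat.zero_add] at this
    intro m n
    obtain ⟨t, h1, h2⟩ := hne (n+m)
    exact this m n t h1 h2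
  obtain ⟨t0, -, ht0⟩ := pig 0 (fun _ => True) (fun m => by simpa using hex m 0)
  have hstep : ∀ n t, ∃ s, (∀ m, D m n t) → R t s ∧ ∀ m, D m (n+1) s := by
    intro n t
    by_cases h : ∀ m, D m n t
    · obtain ⟨s, hs⟩ := pig (n+1) (R t) (fun m => ((hDs _ _ _).1 (h (m+1))).2.2)
      exact ⟨s, fun _ => hs⟩
    · exact ⟨t, fun h' => absurd h' h⟩
  choose nx hnx using hstep
  let a : ℕ → T := fun n => Nat.rec t0 (fun n t => nx n t) n
  have ha : ∀ n m, D m n (a n) := by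
    intro n
    induction n with
    | zero => exact ht0
    | succ n ih => exact (hnx n (a n) ih).2
  exact ⟨a, fun n => hDF 0 n _ (ha n 0), fun n => (hnx n (a n) (ha n)).1⟩

theorem bco_pullback {X Y : Type*} [TopologicalSpace X] [TopologicalSpace Y] (i : X → Y)
    (hi : Continuous i)
    (hl : ∀ x U, IsOpen U → x ∈ U → ∃ V, IsOpen V ∧ i x ∈ V ∧ i ⁻¹' V ⊆ U)
    (h : HasBCO Y) : HasBCO X := by
  obtain ⟨B, hB, hb⟩ := h
  refine bco_of_sieve (T := ℕ × Opens Y) (0, ⊤)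
    (fun t => {s | s.1 = t.1 + 1 ∧ (s.2 : Set Y) ∈ B t.1 ∧ s.2 ≤ t.2})
    (fun t => i ⁻¹' t.2) (by simp) (fun t => t.2.isOpen.preimage hi) ?_ ?_
  · rintro ⟨n, b⟩ y hy
    obtain ⟨P, hP, hyP, hPb⟩ := (hB n).2 b b.isOpen (i y) hy
    exact ⟨(n+1, ⟨P, (hB n).1 P hP⟩), ⟨rfl, hP, hPb⟩, hyP⟩
  · intro a ha0 haS x hx U hU hxU
    have h1 : ∀ n, (a n).1 = n := by
      intro n
      induction n with
      | zero => rw [ha0]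
      | succ n ih => rw [(haS n).1, ih]
    obtain ⟨V, hV, hxV, hVU⟩ := hl x U hU hxU
    obtain ⟨n, hn⟩ := hb (fun n => (a (n+1)).2) (i x)
      (fun n => by have := (haS n).2.1; rwa [h1 n] at this) (fun n => hx (n+1))
      (fun n => (haS (n+1)).2.2) V hV hxV
    exact ⟨n+1, (preimage_mono hn).trans hVU⟩

theorem vfin_isOpen {X : Type*} [TopologicalSpace X] (Ps : Finset (Set X))
    (h : ∀ U ∈ Ps, IsOpen U) : IsOpen {A : VFin X | A.1 ∈ VHyper.vbox Ps} := by
  have h1 : IsOpen (VHyper.vbox Ps) := TopologicalSpace.isOpen_generateFrom_of_mem ⟨Ps, h, rfl⟩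
  exact h1.preimage (f := fun A : VFin X => A.1) continuous_subtype_val

theorem vhyper_nhd {X : Type*} [TopologicalSpace X] (W : Set (VHyper X)) (hW : IsOpen W)
    (A : VHyper X) (hA : A ∈ W) :
    ∃ U : X → Set X, (∀ x, IsOpen (U x)) ∧ (∀ x ∈ A.carrier, x ∈ U x) ∧
      ∀ C : VHyper X, (∀ c ∈ C.carrier, ∃ x ∈ A.carrier, c ∈ U x) →
        (∀ x ∈ A.carrier, (C.carrier ∩ U x).Nonempty) → C ∈ W := by
  classical
  induction hW with
  | basic s hs =>
    obtain ⟨Ps, hPs, rfl⟩ := hs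
    refine ⟨fun x => ⋂ P ∈ Ps.filter (fun P => x ∈ P), P, fun x => ?_, fun x hx => ?_,
      fun C h1 h2 => ⟨fun c hc => ?_, fun P hP => ?_⟩⟩
    · exact isOpen_biInter_finset fun P hP => hPs P (Finset.mem_filter.1 hP).1
    · simp
    · obtain ⟨x, hx, hcx⟩ := h1 c hc
      obtain ⟨P, hP, hxP⟩ := hA.1 hx
      refine ⟨P, hP, ?_⟩
      simp only [mem_iInter] at hcx
      exact hcx P (Finset.mem_filter.2 ⟨hP, hxP⟩)
    · obtain ⟨x, hx, hxP⟩ := hA.2 P hP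
      obtain ⟨c, hc, hcx⟩ := h2 x hx
      simp only [mem_iInter] at hcx
      exact ⟨c, hc, hcx P (Finset.mem_filter.2 ⟨hP, hxP⟩)⟩
  | univ => exact ⟨fun _ => univ, fun _ => isOpen_univ, fun _ _ => trivial, fun _ _ _ => trivial⟩
  | inter s t _ _ ih1 ih2 =>
    obtain ⟨U, hU1, hU2, hU3⟩ := ih1 hA.1
    obtain ⟨V, hV1, hV2, hV3⟩ := ih2 hA.2
    refine ⟨fun x => U x ∩ V x, fun x => (hU1 x).inter (hV1 x), fun x hx => ⟨hU2 x hx, hV2 x hx⟩,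
      fun C h1 h2 => ⟨hU3 C ?_ ?_, hV3 C ?_ ?_⟩⟩
    · intro c hc; obtain ⟨x, hx, h⟩ := h1 c hc; exact ⟨x, hx, h.1⟩
    · intro x hx; obtain ⟨c, hc, h⟩ := h2 x hx; exact ⟨c, hc, h.1⟩
    · intro c hc; obtain ⟨x, hx, h⟩ := h1 c hc; exact ⟨x, hx, h.2⟩
    · intro x hx; obtain ⟨c, hc, h⟩ := h2 x hx; exact ⟨c, hc, h.2⟩
  | sUnion s _ ih =>
    obtain ⟨w, hw, hAw⟩ := hA
    obtain ⟨U, hU1, hU2, hU3⟩ := ih w hw hAw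
    exact ⟨U, hU1, hU2, fun C h1 h2 => ⟨w, hw, hU3 C h1 h2⟩⟩

theorem vfin_nhd {X : Type*} [TopologicalSpace X] (W : Set (VFin X)) (hW : IsOpen W)
    (A : VFin X) (hA : A ∈ W) :
    ∃ U : X → Set X, (∀ x, IsOpen (U x)) ∧ (∀ x ∈ A.1.carrier, x ∈ U x) ∧
      ∀ C : VFin X, (∀ c ∈ C.1.carrier, ∃ x ∈ A.1.carrier, c ∈ U x) →
        (∀ x ∈ A.1.carrier, (C.1.carrier ∩ U x).Nonempty) → C ∈ W := by
  obtain ⟨W', hW', rfl⟩ := isOpen_induced_iff.1 hW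
  obtain ⟨U, h1, h2, h3⟩ := vhyper_nhd W' hW' A.1 hA
  exact ⟨U, h1, h2, fun C => h3 C.1⟩

/-- The basic set in `VFin X` determined by a finite family of open sets. -/
def fbox {X : Type*} [TopologicalSpace X] (F : Finset (Opens X)) : Set (VFin X) :=
  {A | (∀ x ∈ A.1.carrier, ∃ t ∈ F, x ∈ t) ∧ ∀ t ∈ F, ∃ x ∈ A.1.carrier, x ∈ t}

theorem fbox_isOpen {X : Type*} [TopologicalSpace X] (F : Finset (Opens X)) :
    IsOpen (fbox F) := by
  classical
  convert vfin_isOpen (F.image (fun t : Opens X => (t : Set X))) ?_ using 1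
  · ext A
    simp [fbox, VHyper.vbox, Set.subset_def, Set.Nonempty]
  · intro U hU
    obtain ⟨t, _, rfl⟩ := Finset.mem_image.1 hU
    exact t.isOpen

theorem bco_fwd {X : Type*} [TopologicalSpace X] (h : HasBCO X) : HasBCO (VFin X) := by
  classical
  obtain ⟨B, hB, hb⟩ := h
  refine bco_of_sieve (T := ℕ × Finset (Opens X)) (0, {⊤})
    (fun t => {s | s.1 = t.1 + 1 ∧ ∀ u ∈ s.2, (u : Set X) ∈ B t.1 ∧ ∃ v ∈ t.2, u ≤ v})
    (fun t => fbox t.2) ?_ (fun t => fbox_isOpen _) ?_ ?_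
  · ext A
    obtain ⟨x, hx⟩ := A.1.nonempty'
    exact ⟨fun _ => trivial, fun _ => ⟨fun y _ => ⟨⊤, Finset.mem_singleton_self _, trivial⟩,
      fun t ht => ⟨x, hx, by rw [Finset.mem_singleton.1 ht]; trivial⟩⟩⟩
  · rintro ⟨n, F⟩ A hA
    have hs : ∀ (t : Opens X) (x : X), ∃ s : Opens X, x ∈ t → (s : Set X) ∈ B n ∧ x ∈ s ∧ s ≤ t := by
      intro t x
      by_cases hx : x ∈ t
      · obtain ⟨P, hP, hyP, hPb⟩ := (hB n).2 t t.isOpen x hx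
        exact ⟨⟨P, (hB n).1 P hP⟩, fun _ => ⟨hP, hyP, hPb⟩⟩
      · exact ⟨t, fun h => absurd h hx⟩
    choose f hf using hs
    let I : Finset (Opens X × X) := (F ×ˢ A.2.toFinset).filter (fun p => p.2 ∈ p.1)
    have hI : ∀ p, p ∈ I ↔ (p.1 ∈ F ∧ p.2 ∈ A.1.carrier) ∧ p.2 ∈ p.1 := by
      intro p; simp [I]
    refine ⟨(n+1, I.image (fun p => f p.1 p.2)), ⟨rfl, ?_⟩, ?_, ?_⟩
    · intro u hu
      obtain ⟨p, hp, rfl⟩ := Finset.mem_image.1 hu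
      obtain ⟨⟨h1, h2⟩, h3⟩ := (hI p).1 hp
      obtain ⟨h4, h5, h6⟩ := hf _ _ h3
      exact ⟨h4, p.1, h1, h6⟩
    · intro x hx
      obtain ⟨t, ht, hxt⟩ := hA.1 x hx
      exact ⟨f t x, Finset.mem_image.2 ⟨(t, x), (hI _).2 ⟨⟨ht, hx⟩, hxt⟩, rfl⟩, (hf t x hxt).2.1⟩
    · intro u hu
      obtain ⟨p, hp, rfl⟩ := Finset.mem_image.1 hu
      obtain ⟨⟨h1, h2⟩, h3⟩ := (hI p).1 hp
      exact ⟨p.2, h2, (hf _ _ h3).2.1⟩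
  · intro a ha0 haS A hA W hW hAW
    have h1 : ∀ n, (a n).1 = n := by
      intro n
      induction n with
      | zero => rw [ha0]
      | succ n ih => rw [(haS n).1, ih]
    have hS : ∀ n, ∀ u ∈ (a (n+1)).2, (u : Set X) ∈ B n ∧ ∃ v ∈ (a n).2, u ≤ v := by
      intro n
      have := (haS n).2
      rwa [h1 n] at this
    obtain ⟨U, hUo, hUx, hUW⟩ := vfin_nhd W hW A hAW
    have hgood : ∀ x, ∃ n, x ∈ A.1.carrier →
        ∀ t ∈ (a n).2, ¬ (x ∈ t ∧ ¬ (t : Set X) ⊆ U x) := by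
      intro x
      by_cases hx : x ∈ A.1.carrier
      swap
      · exact ⟨0, fun h => absurd h hx⟩
      by_contra! hcon
      obtain ⟨c, hc1, hc2⟩ := konig_aux (fun n => (a n).2)
        (fun t s => s ≤ t) (fun t => x ∈ t ∧ ¬ (t : Set X) ⊆ U x)
        (fun n => (hcon n).2) (fun n s hs hbad => by
          obtain ⟨-, v, hv, hsv⟩ := hS n s hs
          exact ⟨v, hv, ⟨hsv hbad.1, fun h => hbad.2 (Set.Subset.trans hsv h)⟩, hsv⟩)
      obtain ⟨n, hn⟩ := hb (fun n => c (n+1)) x (fun n => (hS n _ (hc1 (n+1)).1).1)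
        (fun n => (hc1 (n+1)).2.1) (fun n => hc2 (n+1)) (U x) (hUo x) (hUx x hx)
      exact (hc1 (n+1)).2.2 hn
    choose N hN using hgood
    have hmono : ∀ x m n, m ≤ n → (∀ t ∈ (a m).2, ¬ (x ∈ t ∧ ¬ (t : Set X) ⊆ U x)) →
        ∀ t ∈ (a n).2, ¬ (x ∈ t ∧ ¬ (t : Set X) ⊆ U x) := by
      intro x m n hmn
      induction hmn with
      | refl => exact id
      | step _ ih =>
        intro h t ht hbad
        obtain ⟨-, v, hv, hsv⟩ := hS _ t ht
        exact ih h v hv ⟨hsv hbad.1, fun h => hbad.2 (Set.Subset.trans hsv h)⟩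
    refine ⟨A.2.toFinset.sup N, fun C hC => ?_⟩
    have hfin : ∀ x ∈ A.1.carrier, ∀ t ∈ (a (A.2.toFinset.sup N)).2, x ∈ t →
        (t : Set X) ⊆ U x := by
      intro x hx t ht hxt
      by_contra hcon
      exact hmono x (N x) _ (Finset.le_sup (A.2.mem_toFinset.2 hx)) (hN x hx) t ht ⟨hxt, hcon⟩
    have hA' := hA (A.2.toFinset.sup N)
    refine hUW C ?_ ?_
    · intro c hc
      obtain ⟨t, ht, hct⟩ := hC.1 c hc
      obtain ⟨x, hx, hxt⟩ := hA'.2 t ht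
      exact ⟨x, hx, hfin x hx t ht hxt hct⟩
    · intro x hx
      obtain ⟨t, ht, hxt⟩ := hA'.1 x hx
      obtain ⟨c, hc, hct⟩ := hC.2 t ht
      exact ⟨c, hc, hfin x hx t ht hxt hct⟩

/-- The singleton map. -/
def vsing {X : Type*} [TopologicalSpace X] (x : X) : VFin X :=
  ⟨⟨{x}, isCompact_singleton, singleton_nonempty x⟩, finite_singleton x⟩

theorem vsing_cont {X : Type*} [TopologicalSpace X] : Continuous (vsing (X := X)) := by
  refine Continuous.subtype_mk (continuous_generateFrom_iff.2 ?_) _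
  rintro _ ⟨Ps, hPs, rfl⟩
  have : ((fun x : X => (⟨{x}, isCompact_singleton, singleton_nonempty x⟩ : VHyper X)) ⁻¹'
      VHyper.vbox Ps) = (⋃₀ (Ps : Set (Set X))) ∩ ⋂ P ∈ Ps, P := by
    ext x
    simp [VHyper.vbox]
  rw [this]
  exact (isOpen_sUnion fun U hU => hPs U hU).inter (isOpen_biInter_finset hPs)

/-- `X` has a base of countable order iff `ℱ(X)` has a base of countable order. -/
theorem statement13 {X : Type*} [TopologicalSpace X] [T2Space X] [RegularSpace X] :
    HasBCO X ↔ HasBCO (VFin X) := by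
  refine ⟨bco_fwd, bco_pullback vsing vsing_cont ?_⟩
  intro x U hU hx
  refine ⟨fbox {⟨U, hU⟩}, fbox_isOpen _, ?_, ?_⟩
  · refine ⟨fun y hy => ⟨⟨U, hU⟩, Finset.mem_singleton_self _, ?_⟩, fun t ht => ⟨x, mem_singleton x, ?_⟩⟩
    · obtain rfl : y = x := hy
      exact hx
    · rw [Finset.mem_singleton.1 ht]
      exact hx
  · intro y hy
    obtain ⟨t, ht, hyt⟩ := hy.1 y (mem_singleton y)
    rw [Finset.mem_singleton] at ht
    subst ht
    exact hyt
end
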